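/- arXiv:1802.02352 — 3 statements merged into one kernel-verified Lean document; each statement's English description precedes it below -/
import Mathlib

section
/- Let E be a finite-dimensional real inner product space and μ a positive Radon measure on E with Θ(μ) ≠ ∅ and μ not concentrated on any affine hyperplane. Define J_μ(m) := sup_{θ ∈ Θ(μ)} e^{−⟨θ,m⟩}/L_μ(θ) for m in the domain of means M_{F(μ)}. Then log J_μ is differentiable on M_{F(μ)} and ψ_μ = −(log J_μ)′, i.e. the inverse of the mean map equals minus the gradient of log J_μ. -/
open MeasureTheory
open scoped RealInnerProductSpace ENNReal

open Topology in
/-- A convex function lying strictly above an affine function except at a contact point grows at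
least linearly away from that point; hence the supremum defining its conjugate is, near the slope
of the affine function, attained near the contact point. -/
theorem ConvexOn.eventually_forall_neg_inner_sub_le
    {E : Type*} [NormedAddCommGroup E] [InnerProductSpace ℝ E] [FiniteDimensional ℝ E]
    {D : Set E} {k : E → ℝ} (hk : ConvexOn ℝ D k) {θ₀ m₀ : E} (hθ₀ : θ₀ ∈ interior D)
    (hlt : ∀ θ ∈ D, θ ≠ θ₀ → k θ₀ - ⟪θ - θ₀, m₀⟫ < k θ) {ε : ℝ} (hε : 0 < ε) :
    ∀ᶠ y in 𝓝 m₀, ∀ θ ∈ D, -⟪θ, y⟫ - k θ ≤ -⟪θ₀, y⟫ - k θ₀ + ε * ‖y - m₀‖ := by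
  obtain ⟨r, hr, hrD⟩ := Metric.nhds_basis_closedBall.mem_iff.1 (isOpen_interior.mem_nhds hθ₀)
  obtain ⟨δ, hδ, hδr, hδε⟩ : ∃ δ > 0, δ ≤ r ∧ δ ≤ ε :=
    ⟨min r ε, lt_min hr hε, min_le_left _ _, min_le_right _ _⟩
  have hsub : Metric.sphere θ₀ δ ⊆ interior D :=
    (Metric.sphere_subset_closedBall.trans (Metric.closedBall_subset_closedBall hδr)).trans hrD
  obtain ⟨c, hc, hcle⟩ := (isCompact_sphere θ₀ δ).exists_forall_le'
    (f := fun θ => k θ - k θ₀ + ⟪θ - θ₀, m₀⟫) (a := 0)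
    (((hk.continuousOn_interior.mono hsub).sub continuousOn_const).add
      (by fun_prop)) (fun θ hθ => by
        have := hlt θ (interior_subset (hsub hθ)) (Metric.ne_of_mem_sphere hθ hδ.ne')
        linarith)
  have hD₀ : θ₀ ∈ D := interior_subset hθ₀
  filter_upwards [Metric.closedBall_mem_nhds m₀ (div_pos hc hδ)] with y hy θ hθ
  rw [mem_closedBall_iff_norm, le_div_iff₀ hδ] at hy
  have hcs : -⟪θ - θ₀, y - m₀⟫ ≤ ‖θ - θ₀‖ * ‖y - m₀‖ :=
    (neg_le_abs _).trans (abs_real_inner_le_norm _ _)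
  have hexp : ⟪θ - θ₀, y - m₀⟫ = ⟪θ, y⟫ - ⟪θ₀, y⟫ - ⟪θ - θ₀, m₀⟫ := by
    simp only [inner_sub_left, inner_sub_right]
  have hny := norm_nonneg (y - m₀)
  rcases le_or_gt ‖θ - θ₀‖ δ with hle | hgt
  · have h0 : k θ₀ - ⟪θ - θ₀, m₀⟫ ≤ k θ := by
      rcases eq_or_ne θ θ₀ with rfl | hne
      · simp
      · exact (hlt θ hθ hne).le
    have := mul_le_mul_of_nonneg_right (hle.trans hδε) hny
    linarith
  · set R := ‖θ - θ₀‖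
    have hR : 0 < R := hδ.trans hgt
    have hs : δ / R ≤ 1 := (div_le_one hR).2 hgt.le
    have hs0 : 0 < δ / R := div_pos hδ hR
    have hpt : (1 - δ / R) • θ₀ + (δ / R) • θ = θ₀ + (δ / R) • (θ - θ₀) := by module
    have hconv := hk.2 hD₀ hθ (sub_nonneg.2 hs) hs0.le (by ring)
    have hc' := hcle (θ₀ + (δ / R) • (θ - θ₀)) (by
      rw [mem_sphere_iff_norm, add_sub_cancel_left, norm_smul, Real.norm_of_nonneg hs0.le]
      exact div_mul_cancel₀ _ hR.ne')
    rw [hpt, smul_eq_mul, smul_eq_mul] at hconv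
    simp only [add_sub_cancel_left, real_inner_smul_left] at hc'
    have hgrow : c ≤ δ / R * (k θ - k θ₀ + ⟪θ - θ₀, m₀⟫) := by linarith
    rw [div_mul_eq_mul_div, le_div_iff₀ hR] at hgrow
    have hbd : R * ‖y - m₀‖ ≤ k θ - k θ₀ + ⟪θ - θ₀, m₀⟫ := by
      refine le_of_mul_le_mul_left ?_ hδ
      have := mul_le_mul_of_nonneg_right hy hR.le
      linarith
    have := mul_nonneg hε.le hny
    linarith

section Laplace

variable {E : Type*} [NormedAddCommGroup E] [InnerProductSpace ℝ E] [MeasurableSpace E]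
  {μ : Measure E}

/-- The effective domain of the Laplace transform of `μ`. -/
def laplaceDomain (μ : Measure E) : Set E := {θ | Integrable (fun x => Real.exp (-⟪θ, x⟫)) μ}

/-- The logarithm of the Laplace transform of `μ`. -/
noncomputable def logLaplace (μ : Measure E) (θ : E) : ℝ :=
  Real.log (∫ x, Real.exp (-⟪θ, x⟫) ∂μ)

theorem exp_logLaplace [NeZero μ] {θ : E} (hθ : θ ∈ laplaceDomain μ) :
    Real.exp (logLaplace μ θ) = ∫ x, Real.exp (-⟪θ, x⟫) ∂μ :=
  Real.exp_log (integral_exp_pos hθ)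

variable [BorelSpace E]

theorem laplaceDomain_eq :
    laplaceDomain μ = {θ | ∫⁻ x, ENNReal.ofReal (Real.exp (-⟪θ, x⟫)) ∂μ < ⊤} := by
  ext θ
  have hm : AEStronglyMeasurable (fun x => Real.exp (-⟪θ, x⟫)) μ :=
    Continuous.aestronglyMeasurable (by fun_prop)
  have h0 : 0 ≤ᵐ[μ] fun x => Real.exp (-⟪θ, x⟫) := ae_of_all _ fun _ => (Real.exp_pos _).le
  exact (and_iff_right hm).trans (hasFiniteIntegral_iff_ofReal h0)

theorem convexOn_logLaplace [NeZero μ] : ConvexOn ℝ (laplaceDomain μ) (logLaplace μ) := by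
  have key : ∀ ⦃θ₁ : E⦄, θ₁ ∈ laplaceDomain μ → ∀ ⦃θ₂ : E⦄, θ₂ ∈ laplaceDomain μ →
      ∀ ⦃a b : ℝ⦄, 0 ≤ a → 0 ≤ b → a + b = 1 →
      ∫⁻ x, ENNReal.ofReal (Real.exp (-⟪a • θ₁ + b • θ₂, x⟫)) ∂μ ≤
        ENNReal.ofReal (Real.exp (a * logLaplace μ θ₁ + b * logLaplace μ θ₂)) := by
    intro θ₁ h₁ θ₂ h₂ a b ha hb hab
    have hol := ENNReal.lintegral_mul_norm_pow_le (μ := μ)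
      (f := fun x => ENNReal.ofReal (Real.exp (-⟪θ₁, x⟫)))
      (g := fun x => ENNReal.ofReal (Real.exp (-⟪θ₂, x⟫)))
      (by fun_prop) (by fun_prop) ha hb hab
    have hL : ∀ θ ∈ laplaceDomain μ, ∫⁻ x, ENNReal.ofReal (Real.exp (-⟪θ, x⟫)) ∂μ =
        ENNReal.ofReal (Real.exp (logLaplace μ θ)) := fun θ hθ => by
      rw [exp_logLaplace hθ, ofReal_integral_eq_lintegral_ofReal hθ
        (ae_of_all _ fun _ => (Real.exp_pos _).le)]
    have hpow : ∀ u v : ℝ, ENNReal.ofReal (Real.exp u) ^ a * ENNReal.ofReal (Real.exp v) ^ b =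
        ENNReal.ofReal (Real.exp (a * u + b * v)) := fun u v => by
      rw [ENNReal.ofReal_rpow_of_pos (Real.exp_pos _), ENNReal.ofReal_rpow_of_pos (Real.exp_pos _),
        ← ENNReal.ofReal_mul (Real.rpow_nonneg (Real.exp_pos _).le _), ← Real.exp_mul,
        ← Real.exp_mul, ← Real.exp_add, mul_comm u, mul_comm v]
    rw [hL θ₁ h₁, hL θ₂ h₂, hpow] at hol
    refine le_trans (le_of_eq (lintegral_congr fun x => ?_)) hol
    rw [hpow, inner_add_left, real_inner_smul_left, real_inner_smul_left]
    congr 2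
    ring
  have hconv : Convex ℝ (laplaceDomain μ) := fun θ₁ h₁ θ₂ h₂ a b ha hb hab => by
    rw [laplaceDomain_eq]
    exact (key h₁ h₂ ha hb hab).trans_lt ENNReal.ofReal_lt_top
  refine ⟨hconv, fun θ₁ h₁ θ₂ h₂ a b ha hb hab => ?_⟩
  have hk := key h₁ h₂ ha hb hab
  have hmem := hconv h₁ h₂ ha hb hab
  rw [← ofReal_integral_eq_lintegral_ofReal hmem (ae_of_all _ fun _ => (Real.exp_pos _).le),
    ← exp_logLaplace hmem, ENNReal.ofReal_le_ofReal_iff (Real.exp_pos _).le,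
    Real.exp_le_exp] at hk
  exact hk

variable [FiniteDimensional ℝ E]

theorem integrable_exp_neg_inner_smul {θ : E} (hθ : θ ∈ interior (laplaceDomain μ)) :
    Integrable (fun x => Real.exp (-⟪θ, x⟫) • x) μ := by
  have hv : ∀ v : E, Integrable (fun x => Real.exp (-⟪θ, x⟫) * ⟪v, x⟫) μ := by
    intro v
    have hcont : Continuous fun t : ℝ => θ + t • v := by fun_prop
    have hcont' : Continuous fun t : ℝ => θ - t • v := by fun_prop
    have h₁ := hcont.continuousAt.preimage_mem_nhds (x := 0)
      (isOpen_interior.mem_nhds (by simpa using hθ))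
    have h₂ := hcont'.continuousAt.preimage_mem_nhds (x := 0)
      (isOpen_interior.mem_nhds (by simpa using hθ))
    obtain ⟨t, ht, ht₁, ht₂⟩ : ∃ t : ℝ, 0 < t ∧ θ + t • v ∈ laplaceDomain μ ∧
        θ - t • v ∈ laplaceDomain μ := by
      obtain ⟨r, hr, hb⟩ := Metric.nhds_basis_closedBall.mem_iff.1 (Filter.inter_mem h₁ h₂)
      have hrm : r ∈ Metric.closedBall (0 : ℝ) r := by simp [abs_of_pos hr]
      exact ⟨r, hr, interior_subset (hb hrm).1, interior_subset (hb hrm).2⟩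
    refine ((Integrable.add ht₁ ht₂).const_mul t⁻¹).mono'
      (Continuous.aestronglyMeasurable (by fun_prop)) (ae_of_all _ fun x => ?_)
    have e₁ : Real.exp (-⟪θ + t • v, x⟫) = Real.exp (-⟪θ, x⟫) * Real.exp (-(t * ⟪v, x⟫)) := by
      rw [← Real.exp_add, inner_add_left, real_inner_smul_left, neg_add]
    have e₂ : Real.exp (-⟪θ - t • v, x⟫) = Real.exp (-⟪θ, x⟫) * Real.exp (t * ⟪v, x⟫) := by
      rw [← Real.exp_add, inner_sub_left, real_inner_smul_left, neg_sub, neg_add_eq_sub]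
    have hle : t * |⟪v, x⟫| ≤ Real.exp (-(t * ⟪v, x⟫)) + Real.exp (t * ⟪v, x⟫) := by
      rw [← abs_of_pos ht, ← abs_mul, abs_of_pos ht, abs_le]
      have a₁ := Real.add_one_le_exp (t * ⟪v, x⟫)
      have a₂ := Real.add_one_le_exp (-(t * ⟪v, x⟫))
      have p₁ := Real.exp_pos (t * ⟪v, x⟫)
      have p₂ := Real.exp_pos (-(t * ⟪v, x⟫))
      constructor <;> linarith
    rw [Pi.add_apply, e₁, e₂, ← mul_add, norm_mul, Real.norm_of_nonneg (Real.exp_pos _).le,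
      Real.norm_eq_abs, inv_mul_eq_div, le_div_iff₀ ht, mul_assoc, mul_comm _ t]
    gcongr
  have hsum : (fun x => Real.exp (-⟪θ, x⟫) • x) = fun x => ∑ i,
      (Real.exp (-⟪θ, x⟫) * ⟪stdOrthonormalBasis ℝ E i, x⟫) • stdOrthonormalBasis ℝ E i := by
    funext x
    simp only [mul_smul, ← Finset.smul_sum, OrthonormalBasis.sum_repr']
  rw [hsum]
  exact integrable_finsetSum _ fun i _ => (hv _).smul_const _

theorem logLaplace_sub_inner_lt [NeZero μ]
    (hμ : ∀ (f : E →ₗ[ℝ] ℝ) (c : ℝ), f ≠ 0 → μ {x | f x = c}ᶜ ≠ 0)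
    {θ₀ m₀ : E} (hθ₀ : θ₀ ∈ interior (laplaceDomain μ))
    (hm₀ : m₀ = (∫ x, Real.exp (-⟪θ₀, x⟫) ∂μ)⁻¹ • ∫ x, Real.exp (-⟪θ₀, x⟫) • x ∂μ)
    {θ : E} (hθ : θ ∈ laplaceDomain μ) (hne : θ ≠ θ₀) :
    logLaplace μ θ₀ - ⟪θ - θ₀, m₀⟫ < logLaplace μ θ := by
  have hmem := interior_subset hθ₀
  have hpos : 0 < ∫ x, Real.exp (-⟪θ₀, x⟫) ∂μ := integral_exp_pos hmem
  set v := θ - θ₀ with hv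
  have hv0 : v ≠ 0 := sub_ne_zero.2 hne
  have hmean : ∫ x, Real.exp (-⟪θ₀, x⟫) * ⟪v, x⟫ ∂μ =
      (∫ x, Real.exp (-⟪θ₀, x⟫) ∂μ) * ⟪v, m₀⟫ := by
    rw [hm₀, real_inner_smul_right, mul_inv_cancel_left₀ hpos.ne',
      ← integral_inner (integrable_exp_neg_inner_smul hθ₀)]
    simp only [real_inner_smul_right]
  have hi : Integrable (fun x => Real.exp (-⟪θ₀, x⟫) * ⟪v, x⟫) μ := by
    simpa only [real_inner_smul_right] using
      (integrable_exp_neg_inner_smul hθ₀).const_inner (𝕜 := ℝ) v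
  have hfact : ∀ x, Real.exp (-⟪θ, x⟫) =
      Real.exp (-⟪v, m₀⟫) * (Real.exp (-⟪θ₀, x⟫) * Real.exp (⟪v, m₀⟫ - ⟪v, x⟫)) := fun x => by
    rw [← Real.exp_add, ← Real.exp_add, hv]
    congr 1
    simp only [inner_sub_left]
    ring
  set g : E → ℝ := fun x => Real.exp (-⟪θ, x⟫) - Real.exp (-⟪v, m₀⟫) *
    (Real.exp (-⟪θ₀, x⟫) * (1 + ⟪v, m₀⟫) - Real.exp (-⟪θ₀, x⟫) * ⟪v, x⟫) with hg
  have hg' : ∀ x, g x = Real.exp (-⟪v, m₀⟫) * (Real.exp (-⟪θ₀, x⟫) *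
      (Real.exp (⟪v, m₀⟫ - ⟪v, x⟫) - (⟪v, m₀⟫ - ⟪v, x⟫ + 1))) := fun x => by
    simp only [hg, hfact]; ring
  have hi' : Integrable (fun x => Real.exp (-⟪v, m₀⟫) *
      (Real.exp (-⟪θ₀, x⟫) * (1 + ⟪v, m₀⟫) - Real.exp (-⟪θ₀, x⟫) * ⟪v, x⟫)) μ :=
    ((Integrable.mul_const hmem (1 + ⟪v, m₀⟫)).sub hi).const_mul _
  have hgi : Integrable g μ := Integrable.sub hθ hi'
  have hg0 : 0 ≤ g := fun x => by
    have := Real.add_one_le_exp (⟪v, m₀⟫ - ⟪v, x⟫)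
    simp only [Pi.zero_apply, hg']
    have := sub_nonneg.2 this
    positivity
  have hgpos : 0 < ∫ x, g x ∂μ := by
    rw [integral_pos_iff_support_of_nonneg hg0 hgi]
    have hf : (innerSL ℝ v).toLinearMap ≠ 0 := fun h => hv0 <| by
      simpa using LinearMap.congr_fun h v
    refine (pos_iff_ne_zero.2 (hμ _ ⟪v, m₀⟫ hf)).trans_le (measure_mono fun x hx => ?_)
    have hx' : ⟪v, m₀⟫ - ⟪v, x⟫ ≠ 0 := sub_ne_zero.2 fun h => hx (by simpa using h.symm)
    rw [Function.mem_support, hg']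
    have := sub_pos.2 (Real.add_one_lt_exp hx')
    positivity
  have hint : ∫ x, g x ∂μ = ∫ x, Real.exp (-⟪θ, x⟫) ∂μ -
      Real.exp (-⟪v, m₀⟫) * ∫ x, Real.exp (-⟪θ₀, x⟫) ∂μ := by
    rw [hg, integral_sub hθ hi', integral_const_mul,
      integral_sub (Integrable.mul_const hmem _) hi, integral_mul_const, hmean]
    ring
  rw [hint, sub_pos, ← exp_logLaplace hmem, ← exp_logLaplace hθ, ← Real.exp_add,
    Real.exp_lt_exp] at hgpos
  linarith

end Laplace

open Topology in
/-- A function squeezed at every scale between an affine function and that function plus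
`ε * ‖y - m‖` has the gradient of the affine function. -/
theorem hasGradientAt_of_affine_le {E : Type*} [NormedAddCommGroup E] [InnerProductSpace ℝ E]
    [CompleteSpace E] {f : E → ℝ} {v m : E} {c : ℝ}
    (h : ∀ ε > 0, ∀ᶠ y in 𝓝 m, ⟪v, y⟫ + c ≤ f y ∧ f y ≤ ⟪v, y⟫ + c + ε * ‖y - m‖) :
    HasGradientAt f v m := by
  have hfm : f m = ⟪v, m⟫ + c := by
    have := (h 1 one_pos).self_of_nhds
    simp only [sub_self, norm_zero, mul_zero, add_zero] at this
    exact le_antisymm this.2 this.1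
  rw [hasGradientAt_iff_isLittleO, Asymptotics.isLittleO_iff]
  intro ε hε
  filter_upwards [h ε hε] with y hy
  rw [Real.norm_eq_abs, hfm, inner_sub_right, abs_le]
  have := mul_nonneg hε.le (norm_nonneg (y - m))
  constructor <;> linarith [hy.1, hy.2]


/-- Let `E` be a finite-dimensional real inner product space and `μ` a
positive Radon measure on `E` whose set `Θ(μ)` (the interior of the set of `θ` where the
Laplace transform `L_μ(θ) = ∫ e^{-⟨θ,x⟩} dμ` is finite) is nonempty, and which is not
concentrated on any affine hyperplane.  Let `mMap θ = L_μ(θ)⁻¹ ∫ x e^{-⟨θ,x⟩} dμ(x)` be the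
mean map (the mean of the exponential family member `P(θ,μ)`), `M = mMap '' Θ(μ)` the domain
of means, and `ψ` the inverse of the mean map.  With
`J_μ(m) = ⨆ θ ∈ Θ(μ), e^{-⟨θ,m⟩} / L_μ(θ)`, the function `log J_μ` is differentiable on `M`
and `ψ = -(log J_μ)'` (gradient with respect to the inner product). -/
theorem statement0
    (E : Type*) [NormedAddCommGroup E] [InnerProductSpace ℝ E] [FiniteDimensional ℝ E]
    [MeasurableSpace E] [BorelSpace E]
    (μ : Measure E) [IsFiniteMeasureOnCompacts μ]
    (L : E → ℝ≥0∞) (hL : ∀ θ, L θ = ∫⁻ x, ENNReal.ofReal (Real.exp (-⟪θ, x⟫)) ∂μ)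
    (Θ : Set E) (hΘ : Θ = interior {θ | L θ < ⊤}) (hΘne : Θ.Nonempty)
    (hhyp : ∀ (f : E →ₗ[ℝ] ℝ) (c : ℝ), f ≠ 0 → μ {x | f x = c}ᶜ ≠ 0)
    (Lr : E → ℝ) (hLr : ∀ θ, Lr θ = ∫ x, Real.exp (-⟪θ, x⟫) ∂μ)
    (mMap : E → E) (hm : ∀ θ ∈ Θ, mMap θ = (Lr θ)⁻¹ • ∫ x, Real.exp (-⟪θ, x⟫) • x ∂μ)
    (M : Set E) (hM : M = mMap '' Θ)
    (ψ : E → E) (hψ : Set.InvOn ψ mMap Θ M)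
    (J : E → ℝ) (hJ : ∀ m, J m = ⨆ θ ∈ Θ, Real.exp (-⟪θ, m⟫) / Lr θ) :
    ∀ m ∈ M, DifferentiableAt ℝ (fun y => Real.log (J y)) m ∧
      ψ m = -gradient (fun y => Real.log (J y)) m := by
  intro m hmM
  cases subsingleton_or_nontrivial E
  · exact ⟨(hasFDerivAt_of_subsingleton _ m).differentiableAt, Subsingleton.elim _ _⟩
  obtain ⟨v, hv⟩ := exists_ne (0 : E)
  have hμ : NeZero μ := ⟨fun h => hhyp (innerSL ℝ v).toLinearMap 0
    (fun h0 => hv (by simpa using LinearMap.congr_fun h0 v)) (by simp [h])⟩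
  have hΘD : Θ = interior (laplaceDomain μ) := by
    rw [hΘ, laplaceDomain_eq]
    simp only [hL]
  obtain ⟨θ₀, hθ₀, rfl⟩ : ∃ θ₀ ∈ Θ, mMap θ₀ = m := by rwa [hM] at hmM
  have hmean := hm θ₀ hθ₀
  rw [hLr] at hmean
  have hterm : ∀ θ ∈ Θ, ∀ y, Real.exp (-⟪θ, y⟫) / Lr θ = Real.exp (-⟪θ, y⟫ - logLaplace μ θ) := by
    intro θ hθ y
    rw [hLr, ← exp_logLaplace (interior_subset (hΘD ▸ hθ)), Real.exp_sub]
  have hgrad : HasGradientAt (fun y => Real.log (J y)) (-θ₀) (mMap θ₀) := by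
    refine hasGradientAt_of_affine_le (c := -logLaplace μ θ₀) fun ε hε => ?_
    filter_upwards [convexOn_logLaplace.eventually_forall_neg_inner_sub_le (hΘD ▸ hθ₀)
      (fun θ hθ hne => logLaplace_sub_inner_lt hhyp (hΘD ▸ hθ₀) hmean hθ hne) hε] with y hy
    have hbd : ∀ θ, ⨆ _ : θ ∈ Θ, Real.exp (-⟪θ, y⟫) / Lr θ ≤
        Real.exp (-⟪θ₀, y⟫ - logLaplace μ θ₀ + ε * ‖y - mMap θ₀‖) := fun θ =>
      Real.iSup_le (fun hθ => by
        rw [hterm θ hθ]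
        exact Real.exp_le_exp.2 (hy θ (interior_subset (hΘD ▸ hθ)))) (Real.exp_pos _).le
    have hle : J y ≤ _ := (hJ y).trans_le (ciSup_le hbd)
    have hge : Real.exp (-⟪θ₀, y⟫ - logLaplace μ θ₀) ≤ J y := by
      rw [hJ]
      refine le_ciSup_of_le ⟨_, Set.forall_mem_range.2 hbd⟩ θ₀ ?_
      rw [ciSup_pos hθ₀, hterm θ₀ hθ₀]
    have hJpos : 0 < J y := (Real.exp_pos _).trans_le hge
    rw [inner_neg_left, ← sub_eq_add_neg]
    exact ⟨(Real.le_log_iff_exp_le hJpos).2 hge, (Real.log_le_iff_le_exp hJpos).2 hle⟩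
  refine ⟨hgrad.differentiableAt, ?_⟩
  rw [hgrad.gradient, neg_neg, hψ.1 hθ₀]
end

section
/- For ξ = ρ*(T)I_N ∈ 𝒬 with T ∈ H and each i = 1,…,r−1, one has det φ_i(ξ) = χ_{m̲_i}(T) · det φ_i(I_N) and det φ̌_i(ξ) = χ_{m̲̌_i}(T) · det φ̌_i(I_N), where m̲_i := (0,…,0,1,dim 𝒱_{i+1,i},…,dim 𝒱_{r,i}) ∈ ℤ^r (the 1 in position i) and m̲̌_i := (0,…,0,0,dim 𝒱_{i+1,i},…,dim 𝒱_{r,i}) ∈ ℤ^r. -/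
open Matrix MeasureTheory Finset
open scoped ENNReal

namespace Wishart

instance {m n α : Type*} [MeasurableSpace α] : MeasurableSpace (Matrix m n α) :=
  inferInstanceAs (MeasurableSpace (m → n → α))

/-- Index set of an `N × N` matrix partitioned into `r + 1` blocks of sizes `n 0, …, n r`. -/
abbrev Idx (r : ℕ) (n : Fin (r + 1) → ℕ+) := Σ k : Fin (r + 1), Fin (n k)

/-- Real matrices over the partitioned index set. -/
abbrev Mat (r : ℕ) (n : Fin (r + 1) → ℕ+) := Matrix (Idx r n) (Idx r n) ℝ

variable {r : ℕ} {n : Fin (r + 1) → ℕ+}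

/-- The `(l,k)` block of a partitioned matrix. -/
def blk (x : Mat r n) (l k : Fin (r + 1)) : Matrix (Fin (n l)) (Fin (n k)) ℝ :=
  Matrix.of fun a b => x ⟨l, a⟩ ⟨k, b⟩

variable (V : ∀ l k : Fin (r + 1), Submodule ℝ (Matrix (Fin (n l)) (Fin (n k)) ℝ))

/-- Condition (V1): `A ∈ 𝒱_{lk}`, `B ∈ 𝒱_{ki}` implies `A B ∈ 𝒱_{li}` for `i < k < l`. -/
def CondV1 : Prop := ∀ i k l : Fin (r + 1), i < k → k < l →
  ∀ A ∈ V l k, ∀ B ∈ V k i, A * B ∈ V l i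

/-- Condition (V2): `A ∈ 𝒱_{li}`, `B ∈ 𝒱_{ki}` implies `A Bᵀ ∈ 𝒱_{lk}` for `i < k < l`. -/
def CondV2 : Prop := ∀ i k l : Fin (r + 1), i < k → k < l →
  ∀ A ∈ V l i, ∀ B ∈ V k i, A * Bᵀ ∈ V l k

/-- Condition (V3): `A ∈ 𝒱_{lk}` implies `A Aᵀ ∈ ℝ I`. -/
def CondV3 : Prop := ∀ k l : Fin (r + 1), k < l →
  ∀ A ∈ V l k, ∃ c : ℝ, A * Aᵀ = c • (1 : Matrix (Fin (n l)) (Fin (n l)) ℝ)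

/-- The space `𝒵` of symmetric matrices with lower blocks in `𝒱_{lk}` and scalar diagonal
blocks. -/
def Zspace : Set (Mat r n) :=
  {x | x.IsSymm ∧ (∀ k l : Fin (r + 1), k < l → blk x l k ∈ V l k) ∧
    ∀ k : Fin (r + 1), ∃ c : ℝ, ∀ a b : Fin (n k),
      x ⟨k, a⟩ ⟨k, b⟩ = if a = b then c else 0}

/-- The trace inner product `⟨x, y⟩ = tr (x y)`. -/
def tip (x y : Mat r n) : ℝ := (x * y).trace

/-- The homogeneous cone `𝒫 = 𝒵 ∩ Sym₊(N, ℝ)`. -/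
def Pcone : Set (Mat r n) := {x | x ∈ Zspace V ∧ x.PosDef}

/-- The dual cone `𝒬 = {ξ ∈ 𝒵 : ⟨ξ, x⟩ > 0 for all nonzero x in the closure of 𝒫}`. -/
def Qcone : Set (Mat r n) :=
  {ξ | ξ ∈ Zspace V ∧ ∀ x ∈ closure (Pcone V), x ≠ 0 → 0 < tip ξ x}

/-- The group `H` of block lower triangular matrices with strictly lower blocks in `𝒱_{lk}`
and positive scalar diagonal blocks. -/
def Hgrp : Set (Mat r n) :=
  {T | (∀ k l : Fin (r + 1), l < k → blk T l k = 0) ∧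
    (∀ k l : Fin (r + 1), k < l → blk T l k ∈ V l k) ∧
    ∀ k : Fin (r + 1), ∃ t : ℝ, 0 < t ∧ ∀ a b : Fin (n k),
      T ⟨k, a⟩ ⟨k, b⟩ = if a = b then t else 0}

/-- `ρ(T) x = T x Tᵀ`. -/
def rhoM (T x : Mat r n) : Mat r n := T * x * Tᵀ

/-- The diagonal scalar `t_{kk}` of a matrix with scalar diagonal blocks. -/
def tdiag (T : Mat r n) (k : Fin (r + 1)) : ℝ :=
  T ⟨k, ⟨0, (n k).2⟩⟩ ⟨k, ⟨0, (n k).2⟩⟩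

/-- The one-dimensional representation `χ_s(T) = ∏_k t_{kk}^{2 s_k}`. -/
noncomputable def chi (s : Fin (r + 1) → ℝ) (T : Mat r n) : ℝ :=
  ∏ k : Fin (r + 1), tdiag T k ^ (2 * s k)

/-- `½ Σ_{i<k} ε_i dim 𝒱_{ki}`. -/
noncomputable def xiBound (ε : Fin (r + 1) → Bool) (k : Fin (r + 1)) : ℝ :=
  (1 / 2) * ∑ i ∈ Finset.univ.filter (fun i => i < k),
    (if ε i then (Module.finrank ℝ (V k i) : ℝ) else 0)

/-- The Gindikin set `Ξ`. -/
def XiSet : Set (Fin (r + 1) → ℝ) :=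
  ⋃ ε : Fin (r + 1) → Bool,
    {s | ∀ k, (ε k = true → xiBound V ε k < s k) ∧ (ε k = false → s k = xiBound V ε k)}

/-- `½ Σ_{l>k} ε_l dim 𝒱_{lk}`. -/
noncomputable def frakBound (ε : Fin (r + 1) → Bool) (k : Fin (r + 1)) : ℝ :=
  (1 / 2) * ∑ l ∈ Finset.univ.filter (fun l => k < l),
    (if ε l then (Module.finrank ℝ (V l k) : ℝ) else 0)

/-- The Gindikin set `𝔛`. -/
def frakX : Set (Fin (r + 1) → ℝ) :=
  ⋃ ε : Fin (r + 1) → Bool,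
    {s | ∀ k, (ε k = true → frakBound V ε k < s k) ∧ (ε k = false → s k = frakBound V ε k)}

/-- Laplace transform `L_μ(θ) = ∫ e^{-⟨θ,x⟩} dμ(x)` (with values in `[0,∞]`). -/
noncomputable def laplace (μ : Measure (Mat r n)) (θ : Mat r n) : ℝ≥0∞ :=
  ∫⁻ x, ENNReal.ofReal (Real.exp (-(tip θ x))) ∂μ

/-- Real-valued Laplace transform. -/
noncomputable def laplaceR (μ : Measure (Mat r n)) (θ : Mat r n) : ℝ :=
  ∫ x, Real.exp (-(tip θ x)) ∂μ

/-- Mean of the natural-exponential-family member `P(θ,μ)`, computed entrywise: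
`m_μ(θ) = L_μ(θ)⁻¹ ∫ x e^{-⟨θ,x⟩} dμ(x)`. -/
noncomputable def meanMap (μ : Measure (Mat r n)) (θ : Mat r n) : Mat r n :=
  Matrix.of fun p q => (laplaceR μ θ)⁻¹ * ∫ x, Real.exp (-(tip θ x)) * x p q ∂μ

/-- Covariance operator of `P(θ,μ)` with mean `m`, applied to `ξ ∈ 𝒵` (entrywise):
`V ξ = ∫ ⟨ξ, x - m⟩ (x - m) dP(θ,μ)(x)`. -/
noncomputable def varOp (μ : Measure (Mat r n)) (θ m ξ : Mat r n) : Mat r n :=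
  Matrix.of fun p q =>
    (laplaceR μ θ)⁻¹ * ∫ x, Real.exp (-(tip θ x)) * tip ξ (x - m) * ((x - m) p q) ∂μ

/-- Leading principal submatrix `y_{{1:k}}` consisting of the blocks with indices `≤ k`. -/
def lead (k : Fin (r + 1)) (y : Mat r n) :
    Matrix {p : Idx r n // p.1 ≤ k} {p : Idx r n // p.1 ≤ k} ℝ :=
  Matrix.of fun p q => y p.1 q.1

/-- Zero-padding `z₀` of a matrix `z` defined on the blocks with indices `≤ k`. -/
def pad (k : Fin (r + 1)) (z : Matrix {p : Idx r n // p.1 ≤ k} {p : Idx r n // p.1 ≤ k} ℝ) :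
    Mat r n :=
  Matrix.of fun p q => if h : p.1 ≤ k ∧ q.1 ≤ k then z ⟨p, h.1⟩ ⟨q, h.2⟩ else 0

/-- `J_k = (I_{N_k})₀`. -/
def Jmat (k : Fin (r + 1)) : Mat r n := pad k 1

/-- Parameters of elements of `W_i`: the scalar `x_{ii}` and the blocks `X_{li}`. -/
abbrev Wparam (r : ℕ) (n : Fin (r + 1) → ℕ+) (i : Fin (r + 1)) :=
  ℝ × ∀ l : Fin (r + 1), Matrix (Fin (n l)) (Fin (n i)) ℝ

/-- The `N × n_i` matrix in `W_i` with `i`-th block row `x_{ii} I` and `l`-th block row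
`X_{li}` for `l > i`. -/
def toW (i : Fin (r + 1)) (p : Wparam r n i) : Matrix (Idx r n) (Fin (n i)) ℝ :=
  Matrix.of fun q b =>
    if q.1 = i then (if (q.2 : ℕ) = (b : ℕ) then p.1 else 0)
    else if i < q.1 then p.2 q.1 q.2 b else 0

/-- A parameter tuple gives an honest element of `W_i`: blocks lie in `𝒱_{li}` and vanish
for `l ≤ i`. -/
def WGood (i : Fin (r + 1)) (p : Wparam r n i) : Prop :=
  (∀ l : Fin (r + 1), i < l → p.2 l ∈ V l i) ∧ (∀ l : Fin (r + 1), ¬ i < l → p.2 l = 0)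

/-- The inner product `(A|B)` on `𝒱_{lk}`, characterized by `(ABᵀ + BAᵀ)/2 = (A|B) I`. -/
noncomputable def bip (l : Fin (r + 1)) {k : Fin (r + 1)}
    (A B : Matrix (Fin (n l)) (Fin (n k)) ℝ) : ℝ :=
  (A * Bᵀ).trace / (n l : ℝ)

open scoped Classical in
/-- The generalized power function `Δ_s` on `𝒫`, defined by `Δ_s(ρ(T) I) = χ_s(T)`. -/
noncomputable def DeltaDef (s : Fin (r + 1) → ℝ) (x : Mat r n) : ℝ :=
  if h : ∃ T, T ∈ Hgrp V ∧ x = rhoM T 1 then chi s h.choose else 0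

/-- Index set for the block diagonal matrix `Φ(ξ) = diag(φ_0(ξ), …, φ_r(ξ))`,
where `φ_i(ξ)` is of size `m_i = mdc i + 1`. -/
abbrev DIdx (r : ℕ) (mdc : Fin (r + 1) → ℕ) := Σ i : Fin (r + 1), Fin (mdc i + 1)

/-- The block diagonal matrix `Φ(ξ) = diag(φ_0(ξ), …, φ_r(ξ))`. -/
def PhiMat {mdc : Fin (r + 1) → ℕ}
    (φ : ∀ i : Fin (r + 1), Mat r n → Matrix (Fin (mdc i + 1)) (Fin (mdc i + 1)) ℝ)
    (ξ : Mat r n) : Matrix (DIdx r mdc) (DIdx r mdc) ℝ :=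
  Matrix.of fun p q =>
    if h : p.1 = q.1 then φ p.1 ξ p.2 (Fin.cast (by rw [h]) q.2) else 0

/-- `Φ(I_N)^{-1/2}`: the inverse square root of the (diagonal, positive) matrix `Φ(I_N)`. -/
noncomputable def PhiISqrtInv {mdc : Fin (r + 1) → ℕ}
    (φ : ∀ i : Fin (r + 1), Mat r n → Matrix (Fin (mdc i + 1)) (Fin (mdc i + 1)) ℝ) :
    Matrix (DIdx r mdc) (DIdx r mdc) ℝ :=
  Matrix.diagonal fun p => (PhiMat φ (1 : Mat r n) p p) ^ (-(1 / 2) : ℝ)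

/-- A block lower triangular endomorphism of a finite product, acting by the scalar `t k` on the
`k`-th diagonal block, has determinant `∏ k, t k ^ dim (M k)`. -/
theorem det_pi_of_lowerTriangular {ι : Type*} [Fintype ι] [LinearOrder ι] {M : ι → Type*}
    [∀ k, AddCommGroup (M k)] [∀ k, Module ℝ (M k)] [∀ k, FiniteDimensional ℝ (M k)]
    (f : (∀ k, M k) →ₗ[ℝ] ∀ k, M k) (t : ι → ℝ)
    (hlow : ∀ k l, l < k → ∀ x : M k, f (Pi.single k x) l = 0)
    (hdiag : ∀ k (x : M k), f (Pi.single k x) k = t k • x) :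
    LinearMap.det f = ∏ k, t k ^ Module.finrank ℝ (M k) := by
  classical
  let s : ∀ k, Module.Basis (Fin (Module.finrank ℝ (M k))) ℝ (M k) := fun k =>
    Module.finBasis ℝ (M k)
  let b := Pi.basis s
  have hentry : ∀ p q, LinearMap.toMatrix b b f p q
      = (s p.1).repr (f (Pi.single q.1 (s q.1 q.2)) p.1) p.2 := fun p q => by
    rw [LinearMap.toMatrix_apply, Pi.basis_repr, Pi.basis_apply]
  have htri : (LinearMap.toMatrix b b f)ᵀ.BlockTriangular Sigma.fst := by
    intro p q hpq
    rw [Matrix.transpose_apply, hentry, hlow _ _ hpq]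
    simp
  rw [← LinearMap.det_toMatrix b, ← Matrix.det_transpose, htri.det_fintype]
  refine Finset.prod_congr rfl fun k _ => ?_
  have hblock : (LinearMap.toMatrix b b f)ᵀ.toSquareBlock Sigma.fst k = t k • 1 := by
    ext ⟨⟨p, a⟩, hp⟩ ⟨⟨q, c⟩, hq⟩
    obtain rfl : p = k := hp
    obtain rfl : q = p := hq
    rw [Matrix.toSquareBlock_def, Matrix.of_apply, Matrix.transpose_apply, hentry, hdiag]
    simp [Finsupp.single_apply, Matrix.one_apply]
  rw [hblock, Matrix.det_smul, Matrix.det_one, mul_one,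
    Fintype.card_congr (Equiv.sigmaSubtype (β := fun k => Fin (Module.finrank ℝ (M k))) k),
    Fintype.card_fin]

/-- Symmetric matrices with the same quadratic form are equal. -/
theorem eq_of_isSymm_of_quadratic {m : Type*} [Fintype m] {A B : Matrix m m ℝ}
    (hA : A.IsSymm) (hB : B.IsSymm) (h : ∀ v, v ⬝ᵥ A *ᵥ v = v ⬝ᵥ B *ᵥ v) : A = B := by
  classical
  have key : ∀ C : Matrix m m ℝ, C.IsSymm → ∀ i j,
      (Pi.single i 1 + Pi.single j 1 : m → ℝ) ⬝ᵥ C *ᵥ (Pi.single i 1 + Pi.single j 1)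
        = C i i + C j j + 2 * C i j := fun C hC i j => by
    have hij : C j i = C i j := hC.apply i j
    simp [Matrix.mulVec_add, add_dotProduct, dotProduct_add, hij]
    ring
  have hd : ∀ i, A i i = B i i := fun i => by
    simpa using h (Pi.single i 1)
  ext i j
  have h1 := h (Pi.single i 1 + Pi.single j 1)
  rw [key A hA, key B hB, hd i, hd j] at h1
  linarith

/-- If the quadratic form of `A` is the pull-back of that of `B` under the endomorphism `f`, read
in the coordinates `E`, then `det A = (det f)² det B`. -/
theorem det_eq_of_quadratic_comp {W m : Type*} [Fintype m] [DecidableEq m] [AddCommGroup W]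
    [Module ℝ W] (E : W ≃ₗ[ℝ] (m → ℝ)) (f : W →ₗ[ℝ] W) {A B : Matrix m m ℝ}
    (hA : A.IsSymm) (hB : B.IsSymm)
    (h : ∀ w, E w ⬝ᵥ A *ᵥ E w = E (f w) ⬝ᵥ B *ᵥ E (f w)) :
    A.det = LinearMap.det f ^ 2 * B.det := by
  set F : Matrix m m ℝ := LinearMap.toMatrix' (E.toLinearMap ∘ₗ f ∘ₗ E.symm.toLinearMap) with hF
  have hFE : ∀ v, F *ᵥ v = E (f (E.symm v)) := fun v => by
    rw [hF, LinearMap.toMatrix'_mulVec]; rfl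
  have hAB : A = Fᵀ * B * F := by
    refine eq_of_isSymm_of_quadratic hA ?_ fun v => ?_
    · rw [Matrix.IsSymm, Matrix.transpose_mul, Matrix.transpose_mul, Matrix.transpose_transpose,
        hB.eq, Matrix.mul_assoc]
    · have := h (E.symm v)
      rw [E.apply_symm_apply, ← hFE] at this
      rw [this, ← Matrix.mulVec_mulVec, ← Matrix.mulVec_mulVec, Matrix.dotProduct_mulVec v,
        Matrix.vecMul_transpose]
  rw [hAB, Matrix.det_mul, Matrix.det_mul, Matrix.det_transpose, hF, LinearMap.det_toMatrix',
    LinearMap.det_conj]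
  ring

/-- The rectangular matrix with constant `c` on its main diagonal. -/
def rectDiag (l i : Fin (r + 1)) (c : ℝ) : Matrix (Fin (n l)) (Fin (n i)) ℝ :=
  Matrix.of fun a b => if (a : ℕ) = (b : ℕ) then c else 0

theorem rectDiag_self (i : Fin (r + 1)) (c : ℝ) :
    (rectDiag i i c : Matrix (Fin (n i)) (Fin (n i)) ℝ) = c • 1 := by
  ext a b
  simp [rectDiag, Matrix.one_apply, Fin.ext_iff]

/-- The block rows of the `i`-th column space: the `i`-th row ranges over `ℝ ε I`, the rows
`l > i` over `𝒱_{li}`, and the rows `l < i` vanish. The column space is `W_i` for `ε = 1` and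
`W̌_i` for `ε = 0`. -/
def colFam (i : Fin (r + 1)) (ε : ℝ) (l : Fin (r + 1)) :
    Submodule ℝ (Matrix (Fin (n l)) (Fin (n i)) ℝ) :=
  if l = i then Submodule.span ℝ {rectDiag l i ε} else if i < l then V l i else ⊥

theorem colFam_of_lt {i l : Fin (r + 1)} (ε : ℝ) (h : i < l) : colFam V i ε l = V l i := by
  simp [colFam, h, h.ne']

theorem colFam_of_gt {i l : Fin (r + 1)} (ε : ℝ) (h : l < i) : colFam V i ε l = ⊥ := by
  simp [colFam, h.ne, h.not_gt]

theorem colFam_self (i : Fin (r + 1)) (ε : ℝ) :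
    colFam V i ε i = Submodule.span ℝ {ε • (1 : Matrix (Fin (n i)) (Fin (n i)) ℝ)} := by
  rw [colFam, if_pos rfl, rectDiag_self]

theorem mem_colFam_self {i : Fin (r + 1)} {ε : ℝ} {A : Matrix (Fin (n i)) (Fin (n i)) ℝ} :
    A ∈ colFam V i ε i ↔ ∃ c : ℝ, A = (c * ε) • (1 : Matrix (Fin (n i)) (Fin (n i)) ℝ) := by
  simp [colFam_self, Submodule.mem_span_singleton, smul_smul, eq_comm]

theorem finrank_colFam (i : Fin (r + 1)) (l : Fin (r + 1)) :
    (Module.finrank ℝ (colFam V i 1 l) : ℝ)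
        = (if l = i then 1 else if i < l then (Module.finrank ℝ (V l i) : ℝ) else 0) ∧
      (Module.finrank ℝ (colFam V i 0 l) : ℝ)
        = if i < l then (Module.finrank ℝ (V l i) : ℝ) else 0 := by
  rcases lt_trichotomy l i with h | rfl | h
  · simp [colFam_of_gt V _ h, h.ne, h.not_gt]
  · have : Nonempty (Fin (n l)) := ⟨⟨0, (n l).2⟩⟩
    have h1 : (1 : Matrix (Fin (n l)) (Fin (n l)) ℝ) ≠ 0 := one_ne_zero
    rw [colFam_self, colFam_self, one_smul, zero_smul, finrank_span_singleton h1]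
    simp
  · rw [colFam_of_lt V _ h, colFam_of_lt V _ h]
    simp [h, h.ne']

/-- The parameters of the element of `W_i` with given block rows. -/
def colParam (i : Fin (r + 1)) (ε : ℝ) : (∀ l, colFam V i ε l) →ₗ[ℝ] Wparam r n i where
  toFun u := ((u i : Matrix (Fin (n i)) (Fin (n i)) ℝ) ⟨0, (n i).2⟩ ⟨0, (n i).2⟩,
    fun l => if i < l then (u l : Matrix (Fin (n l)) (Fin (n i)) ℝ) else 0)
  map_add' u v := by
    refine Prod.ext ?_ (funext fun l => ?_)
    · simp
    · by_cases h : i < l <;> simp [h]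
  map_smul' c u := by
    refine Prod.ext ?_ (funext fun l => ?_)
    · simp
    · by_cases h : i < l <;> simp [h]

variable {V}

theorem col_self {i : Fin (r + 1)} {ε : ℝ} (u : ∀ l, colFam V i ε l) :
    (u i : Matrix (Fin (n i)) (Fin (n i)) ℝ) = (colParam V i ε u).1 • 1 := by
  obtain ⟨c, hc⟩ := (mem_colFam_self V).1 (u i).2
  simp [colParam, hc]

theorem col_of_lt {i : Fin (r + 1)} {ε : ℝ} (u : ∀ l, colFam V i ε l) {l : Fin (r + 1)}
    (h : l < i) : (u l : Matrix (Fin (n l)) (Fin (n i)) ℝ) = 0 :=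
  (Submodule.eq_bot_iff _).1 (colFam_of_gt V ε h) _ (u l).2

theorem col_mem {i : Fin (r + 1)} {ε : ℝ} (u : ∀ l, colFam V i ε l) {l : Fin (r + 1)}
    (h : i < l) : (u l : Matrix (Fin (n l)) (Fin (n i)) ℝ) ∈ V l i :=
  colFam_of_lt V ε h ▸ (u l).2

theorem wGood_colParam {i : Fin (r + 1)} {ε : ℝ} (u : ∀ l, colFam V i ε l) :
    WGood V i (colParam V i ε u) := by
  constructor
  · intro l h
    simpa [colParam, h] using col_mem u h
  · intro l h
    simp [colParam, h]

theorem colParam_zero_fst {i : Fin (r + 1)} (u : ∀ l, colFam V i 0 l) :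
    (colParam V i 0 u).1 = 0 := by
  obtain ⟨c, hc⟩ := (mem_colFam_self V).1 (u i).2
  simp [colParam, hc]

theorem exists_colParam_eq {i : Fin (r + 1)} {ε : ℝ} {p : Wparam r n i} (hp : WGood V i p)
    {c : ℝ} (hc : p.1 = c * ε) : ∃ u, colParam V i ε u = p := by
  have hmem : ∀ l, (if i < l then p.2 l else rectDiag l i (if l = i then p.1 else 0))
      ∈ colFam V i ε l := fun l => by
    rcases lt_trichotomy l i with h | rfl | h
    · rw [if_neg h.not_gt, if_neg h.ne]
      convert Submodule.zero_mem _
      ext a b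
      simp [rectDiag]
    · simp only [lt_irrefl, if_false, if_true, rectDiag_self]
      exact (mem_colFam_self V).2 ⟨c, by rw [hc]⟩
    · rw [if_pos h, colFam_of_lt V ε h]
      exact hp.1 l h
  refine ⟨fun l => ⟨_, hmem l⟩, Prod.ext ?_ (funext fun l => ?_)⟩
  · simp [colParam, rectDiag]
  · by_cases h : i < l
    · simp [colParam, h]
    · simp [colParam, h, hp.2 l h]

theorem toW_colParam {i : Fin (r + 1)} {ε : ℝ} (u : ∀ l, colFam V i ε l) (q : Idx r n)
    (b : Fin (n i)) :
    toW i (colParam V i ε u) q b = (u q.1 : Matrix (Fin (n q.1)) (Fin (n i)) ℝ) q.2 b := by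
  obtain ⟨l, a⟩ := q
  rcases lt_trichotomy l i with h | rfl | h
  · simp [toW, h.ne, h.not_gt, col_of_lt u h]
  · rw [col_self u]
    simp [toW, Matrix.one_apply, Fin.ext_iff]
  · simp [toW, h.ne', h, colParam]

theorem blk_diag_of_mem {T : Mat r n} (hT : T ∈ Hgrp V) (k : Fin (r + 1)) :
    blk T k k = tdiag T k • (1 : Matrix (Fin (n k)) (Fin (n k)) ℝ) := by
  obtain ⟨t, -, ht⟩ := hT.2.2 k
  have h0 : tdiag T k = t := by simp [tdiag, ht]
  ext a b
  simp [blk, ht, h0, Matrix.one_apply]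

theorem tdiag_pos_of_mem {T : Mat r n} (hT : T ∈ Hgrp V) (k : Fin (r + 1)) : 0 < tdiag T k := by
  obtain ⟨t, h, ht⟩ := hT.2.2 k
  simpa [tdiag, ht] using h

theorem blk_mul_mem_colFam (hV1 : CondV1 V) {T : Mat r n} (hT : T ∈ Hgrp V) {i : Fin (r + 1)}
    {ε : ℝ} (u : ∀ l, colFam V i ε l) (l k : Fin (r + 1)) :
    blk T l k * (u k : Matrix (Fin (n k)) (Fin (n i)) ℝ) ∈ colFam V i ε l := by
  rcases lt_trichotomy k l with hkl | rfl | hlk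
  · rcases lt_trichotomy k i with hki | rfl | hik
    · rw [col_of_lt u hki, Matrix.mul_zero]
      exact Submodule.zero_mem _
    · rw [col_self u, Matrix.mul_smul, Matrix.mul_one, colFam_of_lt V ε hkl]
      exact Submodule.smul_mem _ _ (hT.2.1 k l hkl)
    · rw [colFam_of_lt V ε (hik.trans hkl)]
      exact hV1 i k l hik hkl _ (hT.2.1 k l hkl) _ (col_mem u hik)
  · rw [blk_diag_of_mem hT, Matrix.smul_mul, Matrix.one_mul]
    exact Submodule.smul_mem _ _ (u k).2
  · rw [hT.1 k l hlk, Matrix.zero_mul]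
    exact Submodule.zero_mem _

/-- Left multiplication by `T ∈ H` on the `i`-th column space. -/
def colAct (hV1 : CondV1 V) {T : Mat r n} (hT : T ∈ Hgrp V) (i : Fin (r + 1)) (ε : ℝ) :
    (∀ l, colFam V i ε l) →ₗ[ℝ] ∀ l, colFam V i ε l where
  toFun u l := ⟨∑ k, blk T l k * (u k : Matrix (Fin (n k)) (Fin (n i)) ℝ),
    Submodule.sum_mem _ fun k _ => blk_mul_mem_colFam hV1 hT u l k⟩
  map_add' u v := by
    ext l : 2
    simp [Matrix.mul_add, Finset.sum_add_distrib]
  map_smul' c u := by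
    ext l : 2
    simp [Finset.smul_sum]

theorem toW_colParam_colAct (hV1 : CondV1 V) {T : Mat r n} (hT : T ∈ Hgrp V)
    {i : Fin (r + 1)} {ε : ℝ} (u : ∀ l, colFam V i ε l) :
    toW i (colParam V i ε (colAct hV1 hT i ε u)) = T * toW i (colParam V i ε u) := by
  ext q b
  rw [toW_colParam, Matrix.mul_apply, Fintype.sum_sigma]
  simp [colAct, Matrix.sum_apply, Matrix.mul_apply, blk, toW_colParam]

theorem det_colAct (hV1 : CondV1 V) {T : Mat r n} (hT : T ∈ Hgrp V) (i : Fin (r + 1)) (ε : ℝ) :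
    LinearMap.det (colAct hV1 hT i ε)
      = ∏ k, tdiag T k ^ Module.finrank ℝ (colFam V i ε k) := by
  have hsingle : ∀ l k (x : colFam V i ε k),
      ((colAct hV1 hT i ε (Pi.single k x)) l : Matrix (Fin (n l)) (Fin (n i)) ℝ)
        = blk T l k * (x : Matrix (Fin (n k)) (Fin (n i)) ℝ) := fun l k x => by
    simp only [colAct, LinearMap.coe_mk, AddHom.coe_mk]
    rw [Finset.sum_eq_single k]
    · simp
    · intro j _ hj
      simp [Pi.single_eq_of_ne hj]
    · simp
  refine det_pi_of_lowerTriangular _ _ (fun k l hlk x => ?_) fun k x => ?_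
  · ext1
    rw [hsingle, hT.1 k l hlk, Matrix.zero_mul]
    rfl
  · ext1
    rw [hsingle, blk_diag_of_mem hT, Matrix.smul_mul, Matrix.one_mul]
    rfl

theorem toW_mul_transpose_mem (hV2 : CondV2 V) (hV3 : CondV3 V) {i : Fin (r + 1)} {ε : ℝ}
    (u : ∀ l, colFam V i ε l) :
    toW i (colParam V i ε u) * (toW i (colParam V i ε u))ᵀ ∈ Zspace V := by
  have hblk : ∀ l k, blk (toW i (colParam V i ε u) * (toW i (colParam V i ε u))ᵀ) l k
      = (u l : Matrix (Fin (n l)) (Fin (n i)) ℝ)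
        * (u k : Matrix (Fin (n k)) (Fin (n i)) ℝ)ᵀ := fun l k => by
    ext a b
    simp [blk, Matrix.mul_apply, toW_colParam]
  refine ⟨?_, fun k l hkl => ?_, fun k => ?_⟩
  · rw [Matrix.IsSymm, Matrix.transpose_mul, Matrix.transpose_transpose]
  · rw [hblk]
    rcases lt_trichotomy k i with hki | rfl | hik
    · rw [col_of_lt u hki, Matrix.transpose_zero, Matrix.mul_zero]
      exact Submodule.zero_mem _
    · rw [col_self u, Matrix.transpose_smul, Matrix.transpose_one, Matrix.mul_smul,
        Matrix.mul_one]
      exact Submodule.smul_mem _ _ (col_mem u hkl)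
    · exact hV2 i k l hik hkl _ (col_mem u (hik.trans hkl)) _ (col_mem u hik)
  · suffices ∃ c : ℝ, (u k : Matrix (Fin (n k)) (Fin (n i)) ℝ)
        * (u k : Matrix (Fin (n k)) (Fin (n i)) ℝ)ᵀ = c • 1 by
      obtain ⟨c, hc⟩ := this
      refine ⟨c, fun a b => ?_⟩
      have := congrFun (congrFun ((hblk k k).trans hc) a) b
      simpa [blk, Matrix.one_apply] using this
    rcases lt_trichotomy k i with hki | rfl | hik
    · exact ⟨0, by rw [col_of_lt u hki, Matrix.zero_mul, zero_smul]⟩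
    · exact ⟨_, by rw [col_self u, Matrix.transpose_smul, Matrix.transpose_one, Matrix.mul_smul,
        Matrix.mul_one, smul_smul]⟩
    · exact hV3 i k hik _ (col_mem u hik)

theorem one_mem_Zspace : (1 : Mat r n) ∈ Zspace V := by
  refine ⟨Matrix.transpose_one, fun k l hkl => ?_, fun k => ⟨1, fun a b => ?_⟩⟩
  · convert Submodule.zero_mem (V l k)
    ext a b
    simp [blk, hkl.ne']
  · simp [Matrix.one_apply]

theorem bip_self_nonneg {l k : Fin (r + 1)} (A : Matrix (Fin (n l)) (Fin (n k)) ℝ) :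
    0 ≤ bip l A A :=
  div_nonneg (Matrix.posSemidef_self_mul_conjTranspose A).trace_nonneg (Nat.cast_nonneg _)

theorem eq_zero_of_bip_self {l k : Fin (r + 1)} {A : Matrix (Fin (n l)) (Fin (n k)) ℝ}
    (h : bip l A A = 0) : A = 0 := by
  have hn : ((n l : ℕ) : ℝ) ≠ 0 := Nat.cast_ne_zero.2 (n l).ne_zero
  exact Matrix.trace_mul_conjTranspose_self_eq_zero_iff.1 ((div_eq_zero_iff.1 h).resolve_right hn)

theorem eq_zero_of_colParam_sq_sum_eq_zero {i : Fin (r + 1)} {ε : ℝ} {u : ∀ l, colFam V i ε l}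
    (h : (colParam V i ε u).1 * (colParam V i ε u).1
      + ∑ l ∈ Finset.univ.filter (fun l => i < l),
        bip l ((colParam V i ε u).2 l) ((colParam V i ε u).2 l) = 0) : u = 0 := by
  have hs := Finset.sum_nonneg fun l (_ : l ∈ Finset.univ.filter (fun l => i < l)) =>
    bip_self_nonneg ((colParam V i ε u).2 l)
  have h1 := mul_self_nonneg (colParam V i ε u).1
  have hfst : (colParam V i ε u).1 = 0 := mul_self_eq_zero.1 (by linarith)
  have hsum := (Finset.sum_eq_zero_iff_of_nonneg fun l _ =>
    bip_self_nonneg ((colParam V i ε u).2 l)).1 (by linarith)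
  ext l : 2
  rcases lt_trichotomy l i with hl | rfl | hl
  · exact col_of_lt u hl
  · rw [col_self u, hfst, zero_smul]
    rfl
  · have := eq_zero_of_bip_self (hsum l (by simp [hl]))
    simpa [colParam, hl] using this

/-- The determinant of the quadratic form on the `i`-th column space induced by `ρ*(T) I`. -/
theorem det_eq_chi_mul_det (hV1 : CondV1 V) (hV2 : CondV2 V) (hV3 : CondV3 V) {T ξ : Mat r n}
    (hT : T ∈ Hgrp V) (hξ : ∀ x ∈ Zspace V, tip ξ x = tip 1 (rhoM T x)) {i : Fin (r + 1)} {ε : ℝ}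
    {m : ℕ} {E : (∀ l, colFam V i ε l) →ₗ[ℝ] (Fin m → ℝ)} (hE : Function.Bijective E)
    {A B : Matrix (Fin m) (Fin m) ℝ} (hA : A.IsSymm) (hB : B.IsSymm)
    (hqA : ∀ u, E u ⬝ᵥ A *ᵥ E u
      = tip ξ (toW i (colParam V i ε u) * (toW i (colParam V i ε u))ᵀ))
    (hqB : ∀ u, E u ⬝ᵥ B *ᵥ E u
      = tip 1 (toW i (colParam V i ε u) * (toW i (colParam V i ε u))ᵀ)) :
    A.det = chi (fun k => (Module.finrank ℝ (colFam V i ε k) : ℝ)) T * B.det := by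
  rw [det_eq_of_quadratic_comp (LinearEquiv.ofBijective E hE) (colAct hV1 hT i ε) hA hB
    fun u => ?_, det_colAct, chi, ← Finset.prod_pow]
  · congr 1
    refine Finset.prod_congr rfl fun k _ => ?_
    rw [← pow_mul, mul_comm, ← Real.rpow_natCast]
    push_cast
    rfl
  · rw [LinearEquiv.ofBijective_apply, LinearEquiv.ofBijective_apply, hqA, hqB,
      hξ _ (toW_mul_transpose_mem hV2 hV3 u), toW_colParam_colAct, rhoM, Matrix.transpose_mul]
    simp only [Matrix.mul_assoc]

/-- For `ξ = ρ*(T) I_N ∈ 𝒬` with `T ∈ H` and each non-maximal block index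
`i`, one has `det φ_i(ξ) = χ_{m̲_i}(T) · det φ_i(I_N)` and
`det φ̌_i(ξ) = χ_{m̲̌_i}(T) · det φ̌_i(I_N)`, where
`m̲_i = (0, …, 0, 1, dim 𝒱_{i+1,i}, …, dim 𝒱_{r,i})` (the `1` in position `i`) and
`m̲̌_i = (0, …, 0, 0, dim 𝒱_{i+1,i}, …, dim 𝒱_{r,i})`. -/
theorem statement1 (r : ℕ) (n : Fin (r + 1) → ℕ+)
    (V : ∀ l k : Fin (r + 1), Submodule ℝ (Matrix (Fin (n l)) (Fin (n k)) ℝ))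
    (hV1 : CondV1 V) (hV2 : CondV2 V) (hV3 : CondV3 V)
    (rstar : Mat r n → Mat r n → Mat r n)
    (hrstar : ∀ T ∈ Hgrp V, ∀ ξ ∈ Zspace V, rstar T ξ ∈ Zspace V ∧
      ∀ x ∈ Zspace V, tip (rstar T ξ) x = tip ξ (rhoM T x))
    (mdc : Fin (r + 1) → ℕ)
    (hmdc : ∀ i, mdc i = ∑ l ∈ Finset.univ.filter (fun l => i < l), Module.finrank ℝ (V l i))
    (vc : ∀ i : Fin (r + 1), Wparam r n i → (Fin (mdc i + 1) → ℝ))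
    (hvclin : ∀ i, IsLinearMap ℝ (vc i))
    (hvc0 : ∀ i p, WGood V i p → vc i p 0 = p.1)
    (hvcip : ∀ i p p', WGood V i p → WGood V i p' →
      ∑ j, vc i p j * vc i p' j
        = p.1 * p'.1 + ∑ l ∈ Finset.univ.filter (fun l => i < l), bip l (p.2 l) (p'.2 l))
    (hvcsurj : ∀ i (v : Fin (mdc i + 1) → ℝ), ∃ p, WGood V i p ∧ vc i p = v)
    (φ : ∀ i : Fin (r + 1), Mat r n → Matrix (Fin (mdc i + 1)) (Fin (mdc i + 1)) ℝ)
    (hφ : ∀ i, ∀ ξ ∈ Zspace V, (φ i ξ).IsSymm ∧ ∀ p, WGood V i p →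
      vc i p ⬝ᵥ (φ i ξ).mulVec (vc i p) = tip ξ (toW i p * (toW i p)ᵀ))
    (φc : ∀ i : Fin (r + 1), Mat r n → Matrix (Fin (mdc i)) (Fin (mdc i)) ℝ)
    (hφc : ∀ i, ∀ ξ ∈ Zspace V, (φc i ξ).IsSymm ∧ ∀ p, WGood V i p → p.1 = 0 →
      (fun j => vc i p j.succ) ⬝ᵥ (φc i ξ).mulVec (fun j => vc i p j.succ)
        = tip ξ (toW i p * (toW i p)ᵀ)) :
    ∀ T ∈ Hgrp V, ∀ i : Fin (r + 1), i ≠ Fin.last r →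
      (φ i (rstar T 1)).det
          = chi (fun k => if k = i then 1
              else if i < k then (Module.finrank ℝ (V k i) : ℝ) else 0) T
            * (φ i (1 : Mat r n)).det ∧
      (φc i (rstar T 1)).det
          = chi (fun k => if i < k then (Module.finrank ℝ (V k i) : ℝ) else 0) T
            * (φc i (1 : Mat r n)).det := by
  intro T hT i _
  obtain ⟨hZ, htip⟩ := hrstar T hT 1 one_mem_Zspace
  have hinj : ∀ ε (u : ∀ l, colFam V i ε l), vc i (colParam V i ε u) = 0 → u = 0 := by
    intro ε u hu
    refine eq_zero_of_colParam_sq_sum_eq_zero ?_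
    rw [← hvcip i _ _ (wGood_colParam u) (wGood_colParam u), hu]
    simp
  let e := (hvclin i).mk'
  constructor
  · have hE : Function.Bijective (e ∘ₗ colParam V i 1) := by
      refine ⟨(injective_iff_map_eq_zero _).2 fun u hu => hinj 1 u hu, fun v => ?_⟩
      obtain ⟨p, hp, rfl⟩ := hvcsurj i v
      obtain ⟨u, rfl⟩ := exists_colParam_eq hp (mul_one p.1).symm
      exact ⟨u, rfl⟩
    rw [det_eq_chi_mul_det hV1 hV2 hV3 hT htip hE (hφ i _ hZ).1 (hφ i 1 one_mem_Zspace).1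
      (fun u => (hφ i _ hZ).2 _ (wGood_colParam u))
      fun u => (hφ i 1 one_mem_Zspace).2 _ (wGood_colParam u)]
    simp only [(finrank_colFam V i _).1]
  · have hE : Function.Bijective
        (LinearMap.funLeft ℝ ℝ Fin.succ ∘ₗ e ∘ₗ colParam V i 0) := by
      refine ⟨(injective_iff_map_eq_zero _).2 fun u hu => hinj 0 u ?_, fun v => ?_⟩
      · refine funext fun j => ?_
        cases j using Fin.cases with
        | zero => rw [hvc0 i _ (wGood_colParam u), colParam_zero_fst]; rfl
        | succ j => exact congrFun hu j
      · obtain ⟨p, hp, hpv⟩ := hvcsurj i (Fin.cons 0 v)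
        have hp0 : p.1 = 0 := by rw [← hvc0 i p hp, hpv, Fin.cons_zero]
        obtain ⟨u, rfl⟩ := exists_colParam_eq hp (hp0.trans (mul_zero 0).symm)
        refine ⟨u, funext fun j => ?_⟩
        exact (congrFun hpv j.succ).trans (Fin.cons_succ _ _ _)
    rw [det_eq_chi_mul_det hV1 hV2 hV3 hT htip hE (hφc i _ hZ).1 (hφc i 1 one_mem_Zspace).1
      (fun u => (hφc i _ hZ).2 _ (wGood_colParam u) (colParam_zero_fst u))
      fun u => (hφc i 1 one_mem_Zspace).2 _ (wGood_colParam u) (colParam_zero_fst u)]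
    simp only [(finrank_colFam V i _).2]

end Wishart
end

section
/- For every ξ ∈ 𝒬 and every s ∈ ℝ^r, δ_s(ξ) = C_s · φ_r(ξ)^{s_r} · ∏_{i=1}^{r−1} (det φ_i(ξ)/det φ̌_i(ξ))^{s_i}, where the constant C_s = ∏_{i=1}^{r} n_i^{−s_i} does not depend on ξ (note φ_r(ξ) = n_r ξ_{rr} ∈ ℝ and all the determinants above are positive for ξ ∈ 𝒬). -/
open Matrix MeasureTheory Finset
open scoped ENNReal

namespace Wishart

variable {r : ℕ} {n : Fin (r + 1) → ℕ+}

variable (V : ∀ l k : Fin (r + 1), Submodule ℝ (Matrix (Fin (n l)) (Fin (n k)) ℝ))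

/-- The `l`-th block row of a matrix whose rows are partitioned. -/
def rowBlk {κ : Type*} (w : Matrix (Idx r n) κ ℝ) (l : Fin (r + 1)) :
    Matrix (Fin (n l)) κ ℝ :=
  w.submatrix (fun a => ⟨l, a⟩) id

/-- The `i`-th block column of a partitioned matrix. -/
def colBlk (A : Mat r n) (i : Fin (r + 1)) : Matrix (Idx r n) (Fin (n i)) ℝ :=
  A.submatrix id (fun b => ⟨i, b⟩)

theorem rowBlk_ext {κ : Type*} {w w' : Matrix (Idx r n) κ ℝ}
    (h : ∀ l, rowBlk w l = rowBlk w' l) : w = w' := by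
  ext ⟨l, a⟩ b
  exact congrFun (congrFun (h l) a) b

theorem rowBlk_mul {κ : Type*} (A : Mat r n) (w : Matrix (Idx r n) κ ℝ) (l : Fin (r + 1)) :
    rowBlk (A * w) l = ∑ k, blk A l k * rowBlk w k := by
  ext a b
  simp [rowBlk, blk, Matrix.mul_apply, Matrix.sum_apply, Fintype.sum_sigma]

theorem blk_mul_transpose {κ : Type*} [Fintype κ] (w w' : Matrix (Idx r n) κ ℝ)
    (l k : Fin (r + 1)) : blk (w * w'ᵀ) l k = rowBlk w l * (rowBlk w' k)ᵀ := by
  ext a b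
  simp [rowBlk, blk, Matrix.mul_apply]

theorem colBlk_mul (A B : Mat r n) (i : Fin (r + 1)) : colBlk (A * B) i = A * colBlk B i := by
  ext a b
  simp [colBlk, Matrix.mul_apply]

theorem mul_transpose_eq_sum_colBlk (A B : Mat r n) :
    A * Bᵀ = ∑ i, colBlk A i * (colBlk B i)ᵀ := by
  ext a b
  simp [colBlk, Matrix.mul_apply, Matrix.sum_apply, Fintype.sum_sigma]

theorem rowBlk_colBlk (A : Mat r n) (l i : Fin (r + 1)) : rowBlk (colBlk A i) l = blk A l i := rfl

theorem blk_one_self (i : Fin (r + 1)) : blk (1 : Mat r n) i i = 1 := by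
  ext a b
  simp [blk, Matrix.one_apply]

theorem blk_one_of_ne {l i : Fin (r + 1)} (h : l ≠ i) : blk (1 : Mat r n) l i = 0 := by
  ext a b
  simp [blk, h]

/-- Membership in `W_i` of a matrix with `x_{ii} = c`. -/
structure IsW (i : Fin (r + 1)) (c : ℝ) (w : Matrix (Idx r n) (Fin (n i)) ℝ) : Prop where
  zero : ∀ l < i, rowBlk w l = 0
  diag : rowBlk w i = c • (1 : Matrix (Fin (n i)) (Fin (n i)) ℝ)
  mem : ∀ l, i < l → rowBlk w l ∈ V l i

/-- Block lower triangular matrices with scalar diagonal blocks `t k • 1` and strictly lower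
blocks in `𝒱_{lk}`. -/
def IsLower (t : Fin (r + 1) → ℝ) (A : Mat r n) : Prop := ∀ i, IsW V i (t i) (colBlk A i)

variable {V}

theorem IsW.add {i : Fin (r + 1)} {c c' : ℝ} {w w' : Matrix (Idx r n) (Fin (n i)) ℝ}
    (h : IsW V i c w) (h' : IsW V i c' w') : IsW V i (c + c') (w + w') where
  zero l hl := by
    change rowBlk w l + rowBlk w' l = 0
    rw [h.zero l hl, h'.zero l hl, add_zero]
  diag := by
    change rowBlk w i + rowBlk w' i = _
    rw [h.diag, h'.diag, add_smul]
  mem l hl := (V l i).add_mem (h.mem l hl) (h'.mem l hl)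

theorem IsW.smul {i : Fin (r + 1)} {c : ℝ} {w : Matrix (Idx r n) (Fin (n i)) ℝ}
    (h : IsW V i c w) (a : ℝ) : IsW V i (a * c) (a • w) where
  zero l hl := by
    change a • rowBlk w l = 0
    rw [h.zero l hl, smul_zero]
  diag := by
    change a • rowBlk w i = _
    rw [h.diag, mul_smul]
  mem l hl := (V l i).smul_mem a (h.mem l hl)

theorem isW_zero (i : Fin (r + 1)) : IsW V i 0 (0 : Matrix (Idx r n) (Fin (n i)) ℝ) where
  zero _ _ := rfl
  diag := by rw [zero_smul]; rfl
  mem l _ := (V l i).zero_mem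

theorem isLower_one : IsLower V 1 (1 : Mat r n) := fun i =>
  { zero := fun l hl => blk_one_of_ne hl.ne
    diag := by rw [rowBlk_colBlk, blk_one_self, Pi.one_apply, one_smul]
    mem := fun l hl => by
      rw [rowBlk_colBlk, blk_one_of_ne hl.ne']
      exact (V l i).zero_mem }

theorem IsLower.mul_isW (hV1 : CondV1 V) {t : Fin (r + 1) → ℝ} {S : Mat r n} (hS : IsLower V t S)
    {i : Fin (r + 1)} {c : ℝ} {w : Matrix (Idx r n) (Fin (n i)) ℝ} (hw : IsW V i c w) :
    IsW V i (t i * c) (S * w) where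
  zero l hl := by
    rw [rowBlk_mul]
    refine Finset.sum_eq_zero fun k _ => ?_
    rcases lt_or_ge l k with h | h
    · rw [← rowBlk_colBlk, (hS k).zero l h, Matrix.zero_mul]
    · rw [hw.zero k (h.trans_lt hl), Matrix.mul_zero]
  diag := by
    rw [rowBlk_mul, Finset.sum_eq_single i]
    · rw [← rowBlk_colBlk, (hS i).diag, hw.diag, Matrix.smul_mul, Matrix.one_mul, smul_smul]
    · intro k _ hk
      rcases lt_or_gt_of_ne hk with h | h
      · rw [hw.zero k h, Matrix.mul_zero]
      · rw [← rowBlk_colBlk, (hS k).zero i h, Matrix.zero_mul]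
    · simp
  mem l hl := by
    rw [rowBlk_mul]
    refine (V l i).sum_mem fun k _ => ?_
    rw [← rowBlk_colBlk]
    rcases lt_trichotomy k i with h | rfl | h
    · rw [hw.zero k h, Matrix.mul_zero]
      exact (V l i).zero_mem
    · rw [hw.diag, Matrix.mul_smul, Matrix.mul_one]
      exact (V l k).smul_mem c ((hS k).mem l hl)
    · rcases lt_trichotomy k l with h' | rfl | h'
      · exact hV1 i k l h h' _ ((hS k).mem l h') _ (hw.mem k h)
      · rw [(hS k).diag, Matrix.smul_mul, Matrix.one_mul]
        exact (V k i).smul_mem _ (hw.mem k h)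
      · rw [(hS k).zero l h', Matrix.zero_mul]
        exact (V l i).zero_mem

theorem IsLower.mul (hV1 : CondV1 V) {t u : Fin (r + 1) → ℝ} {S A : Mat r n}
    (hS : IsLower V t S) (hA : IsLower V u A) : IsLower V (t * u) (S * A) := fun i => by
  rw [colBlk_mul]
  exact hS.mul_isW hV1 (hA i)

theorem IsLower.eq_zero_of_mul_eq_zero {κ : Type*} {t : Fin (r + 1) → ℝ} {S : Mat r n}
    (hS : IsLower V t S) (ht : ∀ i, t i ≠ 0) {w : Matrix (Idx r n) κ ℝ} (h : S * w = 0) :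
    w = 0 := by
  refine rowBlk_ext fun l => ?_
  induction l using WellFoundedLT.induction with
  | ind l ih =>
    have h1 := rowBlk_mul S w l
    rw [h, Finset.sum_eq_single l] at h1
    · rw [← rowBlk_colBlk, (hS l).diag, Matrix.smul_mul, Matrix.one_mul] at h1
      exact (smul_eq_zero.mp h1.symm).resolve_left (ht l)
    · intro k _ hk
      rcases lt_or_gt_of_ne hk with h' | h'
      · rw [ih k h']
        exact Matrix.mul_zero _
      · rw [← rowBlk_colBlk, (hS k).zero l h', Matrix.zero_mul]
    · simp

variable (V) in
/-- The linear span of the group `H`. -/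
def lowerSubmodule : Submodule ℝ (Mat r n) where
  carrier := {A | ∃ t, IsLower V t A}
  add_mem' := by
    rintro A B ⟨t, hA⟩ ⟨u, hB⟩
    exact ⟨t + u, fun i => (hA i).add (hB i)⟩
  zero_mem' := ⟨0, fun i => isW_zero i⟩
  smul_mem' := by
    rintro a A ⟨t, hA⟩
    exact ⟨fun i => a * t i, fun i => (hA i).smul a⟩

theorem IsW.unique {i : Fin (r + 1)} {c c' : ℝ} {w : Matrix (Idx r n) (Fin (n i)) ℝ}
    (h : IsW V i c w) (h' : IsW V i c' w) : c = c' := by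
  have := congrFun (congrFun (h.diag.symm.trans h'.diag) ⟨0, (n i).2⟩) ⟨0, (n i).2⟩
  simpa using this

theorem IsLower.exists_inverse (hV1 : CondV1 V) {t : Fin (r + 1) → ℝ} {S : Mat r n}
    (hS : IsLower V t S) (ht : ∀ i, t i ≠ 0) :
    ∃ R, IsLower V t⁻¹ R ∧ S * R = 1 := by
  let f : lowerSubmodule V →ₗ[ℝ] lowerSubmodule V :=
    (LinearMap.mulLeft ℝ S).restrict fun A ⟨u, hA⟩ => ⟨t * u, hS.mul hV1 hA⟩
  have hf : Function.Injective f := by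
    rw [injective_iff_map_eq_zero]
    intro A hA
    exact Subtype.ext (hS.eq_zero_of_mul_eq_zero ht (congrArg Subtype.val hA))
  obtain ⟨⟨R, u, hR⟩, h⟩ := LinearMap.surjective_of_injective hf ⟨1, 1, isLower_one⟩
  have hSR : S * R = 1 := congrArg Subtype.val h
  have htu : t⁻¹ = u := by
    funext i
    have h1 := hS.mul hV1 hR i
    rw [hSR] at h1
    have h2 := h1.unique (isLower_one i)
    rw [Pi.mul_apply, Pi.one_apply] at h2
    rw [Pi.inv_apply]
    exact (eq_inv_of_mul_eq_one_right h2).symm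
  exact ⟨R, htu ▸ hR, hSR⟩

theorem IsLower.mem_Hgrp {t : Fin (r + 1) → ℝ} {T : Mat r n} (hT : IsLower V t T)
    (ht : ∀ i, 0 < t i) : T ∈ Hgrp V :=
  ⟨fun k l h => (hT k).zero l h, fun k l h => (hT k).mem l h, fun k => ⟨t k, ht k, fun a b => by
    have := congrFun (congrFun (hT k).diag a) b
    simpa [rowBlk, colBlk, Matrix.one_apply] using this⟩⟩

theorem IsLower.tdiag_eq {t : Fin (r + 1) → ℝ} {T : Mat r n} (hT : IsLower V t T)
    (k : Fin (r + 1)) : tdiag T k = t k := by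
  have := congrFun (congrFun (hT k).diag ⟨0, (n k).2⟩) ⟨0, (n k).2⟩
  simpa [rowBlk, colBlk, tdiag] using this

theorem mem_Zspace_iff {x : Mat r n} : x ∈ Zspace V ↔ x.IsSymm ∧
    (∀ k l : Fin (r + 1), k < l → blk x l k ∈ V l k) ∧
    ∀ k, ∃ c : ℝ, blk x k k = c • (1 : Matrix (Fin (n k)) (Fin (n k)) ℝ) := by
  simp only [Zspace, Set.mem_ofPred_eq, ← Matrix.ext_iff, blk, Matrix.of_apply, Matrix.smul_apply,
    Matrix.one_apply, smul_eq_mul, mul_ite, mul_one, mul_zero]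

variable (V) in
/-- The space `𝒵` as a submodule. -/
def zSubmodule : Submodule ℝ (Mat r n) where
  carrier := Zspace V
  add_mem' := by
    intro x y hx hy
    rw [mem_Zspace_iff] at *
    refine ⟨hx.1.add hy.1, fun k l h => (V l k).add_mem (hx.2.1 k l h) (hy.2.1 k l h), fun k => ?_⟩
    obtain ⟨c, hc⟩ := hx.2.2 k
    obtain ⟨d, hd⟩ := hy.2.2 k
    refine ⟨c + d, ?_⟩
    rw [add_smul, ← hc, ← hd]
    rfl
  zero_mem' := by
    rw [mem_Zspace_iff]
    exact ⟨Matrix.transpose_zero, fun k l _ => (V l k).zero_mem, fun k => ⟨0, by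
      rw [zero_smul]; rfl⟩⟩
  smul_mem' := by
    intro a x hx
    rw [mem_Zspace_iff] at *
    refine ⟨hx.1.smul a, fun k l h => (V l k).smul_mem a (hx.2.1 k l h), fun k => ?_⟩
    obtain ⟨c, hc⟩ := hx.2.2 k
    refine ⟨a * c, ?_⟩
    rw [mul_smul, ← hc]
    rfl

theorem IsW.mul_transpose_self_mem (hV2 : CondV2 V) (hV3 : CondV3 V) {i : Fin (r + 1)} {c : ℝ}
    {w : Matrix (Idx r n) (Fin (n i)) ℝ} (h : IsW V i c w) : w * wᵀ ∈ Zspace V := by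
  rw [mem_Zspace_iff]
  refine ⟨by rw [Matrix.IsSymm, Matrix.transpose_mul, Matrix.transpose_transpose],
    fun k l hkl => ?_, fun k => ?_⟩
  · rw [blk_mul_transpose]
    rcases lt_trichotomy k i with hk | rfl | hk
    · rw [h.zero k hk, Matrix.transpose_zero, Matrix.mul_zero]
      exact (V l k).zero_mem
    · rw [h.diag, Matrix.transpose_smul, Matrix.transpose_one, Matrix.mul_smul, Matrix.mul_one]
      exact (V l k).smul_mem c (h.mem l hkl)
    · exact hV2 i k l hk hkl _ (h.mem l (hk.trans hkl)) _ (h.mem k hk)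
  · rw [blk_mul_transpose]
    rcases lt_trichotomy k i with hk | rfl | hk
    · exact ⟨0, by rw [h.zero k hk, Matrix.zero_mul, zero_smul]⟩
    · exact ⟨c * c, by
        rw [h.diag, Matrix.transpose_smul, Matrix.transpose_one, Matrix.mul_smul, Matrix.mul_one,
          smul_smul]⟩
    · exact hV3 i k hk _ (h.mem k hk)

theorem IsW.mul_transpose_add_mem (hV2 : CondV2 V) (hV3 : CondV3 V) {i : Fin (r + 1)} {c c' : ℝ}
    {w w' : Matrix (Idx r n) (Fin (n i)) ℝ} (h : IsW V i c w) (h' : IsW V i c' w') :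
    w * w'ᵀ + w' * wᵀ ∈ Zspace V := by
  have key : w * w'ᵀ + w' * wᵀ = (w + w') * (w + w')ᵀ - w * wᵀ - w' * w'ᵀ := by
    rw [Matrix.transpose_add, Matrix.add_mul, Matrix.mul_add, Matrix.mul_add]
    abel
  rw [key]
  exact (zSubmodule V).sub_mem ((zSubmodule V).sub_mem
    ((h.add h').mul_transpose_self_mem hV2 hV3) (h.mul_transpose_self_mem hV2 hV3))
    (h'.mul_transpose_self_mem hV2 hV3)

theorem exists_isLower_add_transpose {x : Mat r n} (hx : x ∈ Zspace V) :
    ∃ t A, IsLower V t A ∧ x = A + Aᵀ := by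
  rw [mem_Zspace_iff] at hx
  obtain ⟨hs, hlow, hdiag⟩ := hx
  choose c hc using hdiag
  let A : Mat r n := Matrix.of fun p q =>
    if q.1 < p.1 then x p q else if p.1 = q.1 then x p q / 2 else 0
  refine ⟨fun i => c i / 2, A, fun i => ⟨fun l hl => ?_, ?_, fun l hl => ?_⟩, ?_⟩
  · ext a b
    simp [A, rowBlk, colBlk, hl.ne, hl.le]
  · ext a b
    have := congrFun (congrFun (hc i) a) b
    simp only [blk, Matrix.of_apply, Matrix.smul_apply, smul_eq_mul] at this
    simp [A, rowBlk, colBlk, this]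
    ring
  · convert hlow i l hl using 1
    ext a b
    simp [A, rowBlk, colBlk, blk, hl]
  · ext p q
    have hpq : x q p = x p q := hs.apply p q
    simp only [A, Matrix.add_apply, Matrix.transpose_apply, Matrix.of_apply, hpq]
    rcases lt_trichotomy p.1 q.1 with h | h | h
    · simp [h, h.ne, h.le]
    · simp [h]
    · simp [h, h.ne, h.le]

theorem tip_transpose {ξ : Mat r n} (hξ : ξ.IsSymm) (y : Mat r n) : tip ξ yᵀ = tip ξ y := by
  rw [tip, tip, ← Matrix.trace_transpose, Matrix.transpose_mul, Matrix.transpose_transpose,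
    hξ.eq, Matrix.trace_mul_comm]

theorem tip_add (ξ x y : Mat r n) : tip ξ (x + y) = tip ξ x + tip ξ y := by
  rw [tip, Matrix.mul_add, Matrix.trace_add, tip, tip]

theorem tip_sum {ι : Type*} (ξ : Mat r n) (s : Finset ι) (x : ι → Mat r n) :
    tip ξ (∑ i ∈ s, x i) = ∑ i ∈ s, tip ξ (x i) := by
  simp only [tip, Matrix.mul_sum, Matrix.trace_sum]

theorem tip_rhoM_add_transpose {ξ : Mat r n} (hξ : ξ.IsSymm) (S A : Mat r n) :
    tip ξ (rhoM S (A + Aᵀ)) = 2 * ∑ i, tip ξ (colBlk (S * A) i * (colBlk S i)ᵀ) := by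
  have h : rhoM S (A + Aᵀ) = S * A * Sᵀ + (S * A * Sᵀ)ᵀ := by
    simp only [rhoM, Matrix.mul_add, Matrix.add_mul, Matrix.transpose_mul,
      Matrix.transpose_transpose, Matrix.mul_assoc]
  rw [h, tip_add, tip_transpose hξ, mul_transpose_eq_sum_colBlk, tip_sum, two_mul]

theorem IsLower.rhoM_mem (hV1 : CondV1 V) (hV2 : CondV2 V) (hV3 : CondV3 V)
    {t : Fin (r + 1) → ℝ} {S : Mat r n} (hS : IsLower V t S) {x : Mat r n} (hx : x ∈ Zspace V) :
    rhoM S x ∈ Zspace V := by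
  obtain ⟨a, A, hA, rfl⟩ := exists_isLower_add_transpose hx
  have h : rhoM S (A + Aᵀ) = S * A * Sᵀ + S * (S * A)ᵀ := by
    simp only [rhoM, Matrix.mul_add, Matrix.add_mul, Matrix.transpose_mul, Matrix.mul_assoc]
  rw [h, mul_transpose_eq_sum_colBlk, mul_transpose_eq_sum_colBlk, ← Finset.sum_add_distrib]
  exact (zSubmodule V).sum_mem fun i _ =>
    (hS.mul hV1 hA i).mul_transpose_add_mem hV2 hV3 (hS i)

theorem tip_self_eq_zero {y : Mat r n} (hy : y.IsSymm) (h : tip y y = 0) : y = 0 := by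
  rw [tip] at h
  nth_rewrite 2 [← hy.eq] at h
  rw [← Matrix.conjTranspose_eq_transpose_of_trivial] at h
  exact Matrix.trace_mul_conjTranspose_self_eq_zero_iff.mp h

theorem eq_of_tip_eq {x y : Mat r n} (hx : x ∈ Zspace V) (hy : y ∈ Zspace V)
    (h : ∀ z ∈ Zspace V, tip x z = tip y z) : x = y := by
  have hxy : x - y ∈ Zspace V := (zSubmodule V).sub_mem hx hy
  refine sub_eq_zero.mp (tip_self_eq_zero hxy.1 ?_)
  have := h _ hxy
  rw [tip, tip] at this
  rw [tip, Matrix.sub_mul, Matrix.trace_sub, this, sub_self]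

theorem IsW.tip_one_mul_colBlk_one {i : Fin (r + 1)} {c : ℝ}
    {w : Matrix (Idx r n) (Fin (n i)) ℝ} (h : IsW V i c w) :
    tip 1 (w * (colBlk (1 : Mat r n) i)ᵀ) = c * (n i : ℕ) := by
  have hone : (colBlk (1 : Mat r n) i)ᵀ * w = rowBlk w i := by
    ext a b
    simp [colBlk, rowBlk, Matrix.mul_apply, Matrix.one_apply]
  rw [tip, Matrix.one_mul, Matrix.trace_mul_comm, hone, h.diag, Matrix.trace_smul,
    Matrix.trace_one, Fintype.card_fin, smul_eq_mul]

/-- If the columns of `S` are orthogonal for `ξ` to the elements of `W_i` up to their `i`-th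
entry, then `ξ` is the image of the identity under `ρ*(S⁻¹)`. -/
theorem IsLower.tip_rhoM_eq (hV1 : CondV1 V) (hV2 : CondV2 V) (hV3 : CondV3 V)
    {τ : Fin (r + 1) → ℝ} (hτ : ∀ i, τ i ≠ 0) {S R : Mat r n} (hS : IsLower V τ⁻¹ S)
    (hR : IsLower V τ R) (hSR : S * R = 1) {ξ : Mat r n} (hξ : ξ.IsSymm)
    (horth : ∀ i c w, IsW V i c w → tip ξ (w * (colBlk S i)ᵀ) = c * (n i : ℕ) * τ i)
    {x : Mat r n} (hx : x ∈ Zspace V) : tip 1 (rhoM R x) = tip ξ x := by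
  obtain ⟨b, B, hB, hy⟩ := exists_isLower_add_transpose (hR.rhoM_mem hV1 hV2 hV3 hx)
  have hxS : x = rhoM S (B + Bᵀ) := by
    have hSR' : Rᵀ * Sᵀ = 1 := by rw [← Matrix.transpose_mul, hSR, Matrix.transpose_one]
    rw [← hy, rhoM, rhoM]
    calc x = (S * R) * x * (Rᵀ * Sᵀ) := by rw [hSR, hSR', Matrix.one_mul, Matrix.mul_one]
      _ = _ := by simp only [Matrix.mul_assoc]
  have h1 : rhoM R x = rhoM 1 (B + Bᵀ) := by
    rw [hy, rhoM, Matrix.transpose_one, Matrix.mul_one, Matrix.one_mul]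
  rw [h1, tip_rhoM_add_transpose Matrix.transpose_one]
  conv_rhs => rw [hxS, tip_rhoM_add_transpose hξ]
  congr 1
  refine Finset.sum_congr rfl fun i _ => ?_
  rw [Matrix.one_mul, (hB i).tip_one_mul_colBlk_one, horth i _ _ (hS.mul hV1 hB i), Pi.mul_apply,
    Pi.inv_apply]
  field_simp [hτ i]

theorem IsW.mul_transpose_self_mem_closure (hV2 : CondV2 V) (hV3 : CondV3 V) {i : Fin (r + 1)}
    {c : ℝ} {w : Matrix (Idx r n) (Fin (n i)) ℝ} (h : IsW V i c w) :
    w * wᵀ ∈ closure (Pcone V) := by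
  have hlim : Filter.Tendsto (fun ε : ℝ => w * wᵀ + ε • (1 : Mat r n))
      (nhdsWithin 0 (Set.Ioi 0)) (nhds (w * wᵀ)) := by
    have : Continuous fun ε : ℝ => w * wᵀ + ε • (1 : Mat r n) := by fun_prop
    have h0 := this.tendsto 0
    rw [zero_smul, add_zero] at h0
    exact h0.mono_left nhdsWithin_le_nhds
  refine mem_closure_of_tendsto hlim ?_
  filter_upwards [self_mem_nhdsWithin] with ε hε
  refine ⟨(zSubmodule V).add_mem (h.mul_transpose_self_mem hV2 hV3)
    ((zSubmodule V).smul_mem ε one_mem_Zspace), ?_⟩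
  refine Matrix.PosDef.posSemidef_add ?_ (Matrix.PosDef.one.smul hε)
  rw [← Matrix.conjTranspose_eq_transpose_of_trivial]
  exact Matrix.posSemidef_self_mul_conjTranspose w

theorem IsW.tip_mul_transpose_self_pos (hV2 : CondV2 V) (hV3 : CondV3 V) {i : Fin (r + 1)}
    {c : ℝ} {w : Matrix (Idx r n) (Fin (n i)) ℝ} (h : IsW V i c w) (hw : w ≠ 0) {ξ : Mat r n}
    (hξ : ξ ∈ Qcone V) : 0 < tip ξ (w * wᵀ) := by
  refine hξ.2 _ (h.mul_transpose_self_mem_closure hV2 hV3) fun h0 => hw ?_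
  rw [← Matrix.conjTranspose_eq_transpose_of_trivial] at h0
  exact Matrix.self_mul_conjTranspose_eq_zero.mp h0

theorem WGood.isW {i : Fin (r + 1)} {p : Wparam r n i} (hp : WGood V i p) :
    IsW V i p.1 (toW i p) where
  zero l hl := by
    ext a b
    simp [rowBlk, toW, hl.ne, hl.le]
  diag := by
    ext a b
    simp [rowBlk, toW, Matrix.one_apply, Fin.ext_iff]
  mem l hl := by
    convert hp.1 l hl using 1
    ext a b
    simp [rowBlk, toW, hl, hl.ne']

theorem IsW.exists_toW {i : Fin (r + 1)} {c : ℝ} {w : Matrix (Idx r n) (Fin (n i)) ℝ}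
    (h : IsW V i c w) : ∃ p, WGood V i p ∧ p.1 = c ∧ toW i p = w := by
  have hp : WGood V i (c, fun l => if i < l then rowBlk w l else 0) :=
    ⟨fun l hl => by simpa [hl] using h.mem l hl, fun l hl => if_neg hl⟩
  refine ⟨_, hp, rfl, rowBlk_ext fun l => ?_⟩
  rcases lt_trichotomy l i with hl | rfl | hl
  · rw [h.zero l hl, hp.isW.zero l hl]
  · rw [h.diag, hp.isW.diag]
  · ext a b
    simp [rowBlk, toW, hl, hl.ne']

theorem WGood.eq_zero_of_toW {i : Fin (r + 1)} {p : Wparam r n i} (hp : WGood V i p)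
    (h : toW i p = 0) : p = 0 := by
  have hW := hp.isW
  rw [h] at hW
  refine Prod.ext (hW.unique (isW_zero i)) (funext fun l => ?_)
  by_cases hl : i < l
  · ext a b
    have := congrFun (congrFun h ⟨l, a⟩) b
    simpa [toW, hl, hl.ne'] using this
  · exact hp.2 l hl

theorem WGood.add {i : Fin (r + 1)} {p q : Wparam r n i} (hp : WGood V i p) (hq : WGood V i q) :
    WGood V i (p + q) :=
  ⟨fun l hl => (V l i).add_mem (hp.1 l hl) (hq.1 l hl), fun l hl => by
    rw [Prod.snd_add, Pi.add_apply, hp.2 l hl, hq.2 l hl, add_zero]⟩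

theorem toW_add (i : Fin (r + 1)) (p q : Wparam r n i) :
    toW i (p + q) = toW i p + toW i q := by
  ext a b
  simp only [toW, Matrix.of_apply, Matrix.add_apply, Prod.fst_add, Prod.snd_add, Pi.add_apply]
  split_ifs <;> simp

theorem isSymm_dotProduct_mulVec_comm {ι : Type*} [Fintype ι] {M : Matrix ι ι ℝ} (hM : M.IsSymm)
    (u v : ι → ℝ) : u ⬝ᵥ M *ᵥ v = v ⬝ᵥ M *ᵥ u := by
  rw [dotProduct_mulVec, ← mulVec_transpose, hM.eq, dotProduct_comm]

theorem isSymm_eq_of_dotProduct_mulVec {ι : Type*} [Fintype ι] {M M' : Matrix ι ι ℝ}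
    (hM : M.IsSymm) (hM' : M'.IsSymm) (h : ∀ v, v ⬝ᵥ M *ᵥ v = v ⬝ᵥ M' *ᵥ v) : M = M' := by
  classical
  have key : ∀ u v, u ⬝ᵥ M *ᵥ v = u ⬝ᵥ M' *ᵥ v := by
    intro u v
    have h1 := h (u + v)
    simp only [mulVec_add, add_dotProduct, dotProduct_add] at h1
    linarith [h u, h v, isSymm_dotProduct_mulVec_comm hM u v,
      isSymm_dotProduct_mulVec_comm hM' u v]
  ext a b
  simpa using key (Pi.single a 1) (Pi.single b 1)

/-- Cramer's rule for the first coordinate of the solution of `M v = c e₀`. -/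
theorem det_eq_of_mulVec_eq_single {m : ℕ} {M : Matrix (Fin (m + 1)) (Fin (m + 1)) ℝ}
    {v : Fin (m + 1) → ℝ} {c : ℝ} (h : M *ᵥ v = Pi.single 0 c) :
    v 0 * M.det = c * (M.submatrix Fin.succ Fin.succ).det := by
  have h1 : M.adjugate *ᵥ (M *ᵥ v) = M.det • v := by
    rw [mulVec_mulVec, adjugate_mul, smul_mulVec, one_mulVec]
  have h2 := congrFun h1 0
  rw [h, mulVec_single] at h2
  simp only [Pi.smul_apply, smul_eq_mul, MulOpposite.smul_eq_mul_unop, MulOpposite.unop_op,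
    Matrix.col_apply, adjugate_fin_succ_eq_det_submatrix] at h2
  simp at h2
  linarith

section Coordinates

variable {i : Fin (r + 1)} {m : ℕ} {vc : Wparam r n i → Fin (m + 1) → ℝ}
  {ξ : Mat r n} {M : Matrix (Fin (m + 1)) (Fin (m + 1)) ℝ}

theorem tip_toW_mul_transpose (hvc : IsLinearMap ℝ vc) (hξ : ξ.IsSymm) (hM : M.IsSymm)
    (hquad : ∀ p, WGood V i p → vc p ⬝ᵥ M *ᵥ vc p = tip ξ (toW i p * (toW i p)ᵀ))
    {p q : Wparam r n i} (hp : WGood V i p) (hq : WGood V i q) :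
    tip ξ (toW i p * (toW i q)ᵀ) = vc p ⬝ᵥ M *ᵥ vc q := by
  have h := hquad _ (hp.add hq)
  rw [hvc.map_add, toW_add, Matrix.transpose_add, Matrix.add_mul, Matrix.mul_add,
    Matrix.mul_add] at h
  simp only [mulVec_add, add_dotProduct, dotProduct_add, tip_add] at h
  have h1 := tip_transpose hξ (toW i p * (toW i q)ᵀ)
  rw [Matrix.transpose_mul, Matrix.transpose_transpose] at h1
  linarith [hquad p hp, hquad q hq, isSymm_dotProduct_mulVec_comm hM (vc p) (vc q)]

theorem posDef_of_mem_Qcone (hV2 : CondV2 V) (hV3 : CondV3 V) (hvc : IsLinearMap ℝ vc)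
    (hsurj : ∀ v, ∃ p, WGood V i p ∧ vc p = v) (hξ : ξ ∈ Qcone V) (hM : M.IsSymm)
    (hquad : ∀ p, WGood V i p → vc p ⬝ᵥ M *ᵥ vc p = tip ξ (toW i p * (toW i p)ᵀ)) :
    M.PosDef := by
  refine Matrix.PosDef.of_dotProduct_mulVec_pos
    ((Matrix.conjTranspose_eq_transpose_of_trivial M).trans hM) fun v hv => ?_
  obtain ⟨p, hp, rfl⟩ := hsurj v
  rw [star_trivial, hquad p hp]
  refine hp.isW.tip_mul_transpose_self_pos hV2 hV3 (fun h0 => hv ?_) hξ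
  rw [hp.eq_zero_of_toW h0, hvc.map_zero]

/-- The `i`-th column of a matrix `S ∈ H` with `ξ = ρ*(S⁻¹) I`. -/
theorem exists_orthogonal_column (hV2 : CondV2 V) (hV3 : CondV3 V) (hvc : IsLinearMap ℝ vc)
    (hvc0 : ∀ p, WGood V i p → vc p 0 = p.1)
    (hsurj : ∀ v, ∃ p, WGood V i p ∧ vc p = v) (hξ : ξ ∈ Qcone V) (hM : M.IsSymm)
    (hquad : ∀ p, WGood V i p → vc p ⬝ᵥ M *ᵥ vc p = tip ξ (toW i p * (toW i p)ᵀ)) :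
    ∃ (τ : ℝ) (w : Matrix (Idx r n) (Fin (n i)) ℝ), 0 < τ ∧ IsW V i τ⁻¹ w ∧
      (∀ c w', IsW V i c w' → tip ξ (w' * wᵀ) = c * (n i : ℕ) * τ) ∧
      M.det = (n i : ℕ) * τ ^ 2 * (M.submatrix Fin.succ Fin.succ).det := by
  have hpos := posDef_of_mem_Qcone hV2 hV3 hvc hsurj hξ hM hquad
  have hn : (0 : ℝ) < (n i : ℕ) := Nat.cast_pos.mpr (n i).2
  set u : Fin (m + 1) → ℝ := M⁻¹ *ᵥ Pi.single 0 1 with hu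
  have hMu : M *ᵥ u = Pi.single 0 1 := by
    rw [hu, mulVec_mulVec, Matrix.mul_nonsing_inv _ hpos.det_pos.ne'.isUnit, one_mulVec]
  have hu0 : 0 < u 0 := by
    have hne : u ≠ 0 := by
      intro h0
      rw [h0, mulVec_zero] at hMu
      simpa using congrFun hMu 0
    have := hpos.dotProduct_mulVec_pos hne
    rwa [hMu, star_trivial, dotProduct_single_one] at this
  set τ : ℝ := √((n i : ℕ) * u 0)⁻¹ with hτ
  have hτpos : 0 < τ := Real.sqrt_pos.mpr (by positivity)
  have hτsq : (n i : ℕ) * τ ^ 2 * u 0 = 1 := by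
    rw [hτ, Real.sq_sqrt (by positivity)]
    field_simp
  set v : Fin (m + 1) → ℝ := ((n i : ℕ) * τ) • u with hv
  have hMv : M *ᵥ v = Pi.single 0 ((n i : ℕ) * τ) := by
    rw [hv, mulVec_smul, hMu, ← Pi.single_smul, smul_eq_mul, mul_one]
  have hv0 : v 0 = τ⁻¹ := by
    rw [hv, Pi.smul_apply, smul_eq_mul]
    refine eq_inv_of_mul_eq_one_left ?_
    rw [← hτsq]
    ring
  obtain ⟨p, hp, hpv⟩ := hsurj v
  refine ⟨τ, toW i p, hτpos, ?_, fun c w' hw' => ?_, ?_⟩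
  · rw [← hv0, ← hpv, hvc0 p hp]
    exact hp.isW
  · obtain ⟨q, hq, rfl, rfl⟩ := hw'.exists_toW
    rw [tip_toW_mul_transpose hvc hξ.1.1 hM hquad hq hp, hpv, hMv, dotProduct_single, hvc0 q hq,
      mul_assoc]
  · have h := det_eq_of_mulVec_eq_single hMv
    rw [hv0] at h
    field_simp at h
    linarith

theorem submatrix_succ_eq (hvc0 : ∀ p, WGood V i p → vc p 0 = p.1)
    (hsurj : ∀ v, ∃ p, WGood V i p ∧ vc p = v) (hM : M.IsSymm)
    (hquad : ∀ p, WGood V i p → vc p ⬝ᵥ M *ᵥ vc p = tip ξ (toW i p * (toW i p)ᵀ))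
    {M' : Matrix (Fin m) (Fin m) ℝ} (hM' : M'.IsSymm)
    (hquad' : ∀ p, WGood V i p → p.1 = 0 →
      (fun j => vc p (Fin.succ j)) ⬝ᵥ M' *ᵥ (fun j => vc p (Fin.succ j))
        = tip ξ (toW i p * (toW i p)ᵀ)) :
    M.submatrix Fin.succ Fin.succ = M' := by
  refine isSymm_eq_of_dotProduct_mulVec (hM.submatrix _) hM' fun z => ?_
  obtain ⟨p, hp, hpz⟩ := hsurj (Fin.cons 0 z)
  have hp0 : p.1 = 0 := by rw [← hvc0 p hp, hpz, Fin.cons_zero]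
  have h := (hquad p hp).trans (hquad' p hp hp0).symm
  simp only [hpz, Fin.cons_succ] at h
  rw [← h]
  simp [dotProduct, mulVec, Fin.sum_univ_succ]

end Coordinates

/-- For every `ξ ∈ 𝒬` and every `s ∈ ℝ^r`,
`δ_s(ξ) = C_s · φ_r(ξ)^{s_r} · ∏_{i<r} (det φ_i(ξ) / det φ̌_i(ξ))^{s_i}`, where
`C_s = ∏_i n_i^{-s_i}` does not depend on `ξ` (and `φ_r(ξ)` as well as all the
determinants appearing are positive for `ξ ∈ 𝒬`). -/
theorem statement2 (r : ℕ) (n : Fin (r + 1) → ℕ+)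
    (V : ∀ l k : Fin (r + 1), Submodule ℝ (Matrix (Fin (n l)) (Fin (n k)) ℝ))
    (hV1 : CondV1 V) (hV2 : CondV2 V) (hV3 : CondV3 V)
    (rstar : Mat r n → Mat r n → Mat r n)
    (hrstar : ∀ T ∈ Hgrp V, ∀ ξ ∈ Zspace V, rstar T ξ ∈ Zspace V ∧
      ∀ x ∈ Zspace V, tip (rstar T ξ) x = tip ξ (rhoM T x))
    (δf : (Fin (r + 1) → ℝ) → Mat r n → ℝ)
    (hδ : ∀ s : Fin (r + 1) → ℝ, ∀ T ∈ Hgrp V, δf s (rstar T 1) = chi s T)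
    (mdc : Fin (r + 1) → ℕ)
    (hmdc : ∀ i, mdc i = ∑ l ∈ Finset.univ.filter (fun l => i < l), Module.finrank ℝ (V l i))
    (vc : ∀ i : Fin (r + 1), Wparam r n i → (Fin (mdc i + 1) → ℝ))
    (hvclin : ∀ i, IsLinearMap ℝ (vc i))
    (hvc0 : ∀ i p, WGood V i p → vc i p 0 = p.1)
    (hvcip : ∀ i p p', WGood V i p → WGood V i p' →
      ∑ j, vc i p j * vc i p' j
        = p.1 * p'.1 + ∑ l ∈ Finset.univ.filter (fun l => i < l), bip l (p.2 l) (p'.2 l))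
    (hvcsurj : ∀ i (v : Fin (mdc i + 1) → ℝ), ∃ p, WGood V i p ∧ vc i p = v)
    (φ : ∀ i : Fin (r + 1), Mat r n → Matrix (Fin (mdc i + 1)) (Fin (mdc i + 1)) ℝ)
    (hφ : ∀ i, ∀ ξ ∈ Zspace V, (φ i ξ).IsSymm ∧ ∀ p, WGood V i p →
      vc i p ⬝ᵥ (φ i ξ).mulVec (vc i p) = tip ξ (toW i p * (toW i p)ᵀ))
    (φc : ∀ i : Fin (r + 1), Mat r n → Matrix (Fin (mdc i)) (Fin (mdc i)) ℝ)
    (hφc : ∀ i, ∀ ξ ∈ Zspace V, (φc i ξ).IsSymm ∧ ∀ p, WGood V i p → p.1 = 0 →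
      (fun j => vc i p j.succ) ⬝ᵥ (φc i ξ).mulVec (fun j => vc i p j.succ)
        = tip ξ (toW i p * (toW i p)ᵀ)) :
    ∀ s : Fin (r + 1) → ℝ, ∀ ξ ∈ Qcone V,
      (0 < (φ (Fin.last r) ξ) 0 0) ∧
      (∀ i : Fin (r + 1), i ≠ Fin.last r → 0 < (φ i ξ).det ∧ 0 < (φc i ξ).det) ∧
      δf s ξ = (∏ i : Fin (r + 1), ((n i : ℕ) : ℝ) ^ (-(s i)))
          * ((φ (Fin.last r) ξ) 0 0) ^ (s (Fin.last r))
          * ∏ i ∈ Finset.univ.filter (fun i => i ≠ Fin.last r),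
              ((φ i ξ).det / (φc i ξ).det) ^ (s i) := by
  intro s ξ hξ
  have hsymm i := (hφ i ξ hξ.1).1
  have hquad i := (hφ i ξ hξ.1).2
  have hpos : ∀ i, (φ i ξ).PosDef := fun i =>
    posDef_of_mem_Qcone hV2 hV3 (hvclin i) (hvcsurj i) hξ (hsymm i) (hquad i)
  have hsub : ∀ i, (φ i ξ).submatrix Fin.succ Fin.succ = φc i ξ := fun i =>
    submatrix_succ_eq (hvc0 i) (hvcsurj i) (hsymm i) (hquad i) (hφc i ξ hξ.1).1 (hφc i ξ hξ.1).2
  have hdetc : ∀ i, 0 < (φc i ξ).det := fun i => by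
    rw [← hsub i]
    exact ((hpos i).submatrix (Fin.succ_injective _)).det_pos
  choose τ w hτ hw horth hdet using fun i =>
    exists_orthogonal_column hV2 hV3 (hvclin i) (hvc0 i) (hvcsurj i) hξ (hsymm i) (hquad i)
  have hn : ∀ i, (0 : ℝ) < (n i : ℕ) := fun i => Nat.cast_pos.mpr (n i).2
  have hratio : ∀ i, (φ i ξ).det / (φc i ξ).det = (n i : ℕ) * τ i ^ 2 := fun i => by
    rw [div_eq_iff (hdetc i).ne', hdet i, hsub i]
  have hlast : (φ (Fin.last r) ξ) 0 0 = (φ (Fin.last r) ξ).det / (φc (Fin.last r) ξ).det := by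
    have hm : mdc (Fin.last r) = 0 := by
      rw [hmdc]
      refine Finset.sum_eq_zero fun l hl => ?_
      exact absurd (Finset.mem_filter.mp hl).2 (Fin.le_last l).not_gt
    rw [← hsub]
    generalize φ (Fin.last r) ξ = M
    revert M
    rw [hm]
    intro M
    simp
  let S : Mat r n := Matrix.of fun q p => w p.1 q p.2
  have hS : IsLower V τ⁻¹ S := hw
  obtain ⟨R, hR, hSR⟩ := hS.exists_inverse hV1 fun i => inv_ne_zero (hτ i).ne'
  rw [inv_inv] at hR
  have hRH := hR.mem_Hgrp hτ
  have hξR : rstar R 1 = ξ := by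
    obtain ⟨h1, h2⟩ := hrstar R hRH 1 one_mem_Zspace
    refine eq_of_tip_eq h1 hξ.1 fun x hx => (h2 x hx).trans ?_
    exact hS.tip_rhoM_eq hV1 hV2 hV3 (fun i => (hτ i).ne') hR hSR hξ.1.1 horth hx
  refine ⟨?_, fun i _ => ⟨(hpos i).det_pos, hdetc i⟩, ?_⟩
  · exact (hpos _).diag_pos
  · have hprod : ((φ (Fin.last r) ξ) 0 0) ^ (s (Fin.last r)) *
        ∏ i ∈ Finset.univ.filter (fun i => i ≠ Fin.last r),
          ((φ i ξ).det / (φc i ξ).det) ^ (s i)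
        = ∏ i, ((φ i ξ).det / (φc i ξ).det) ^ (s i) := by
      rw [hlast, Finset.filter_ne', Finset.mul_prod_erase _
        (fun i => ((φ i ξ).det / (φc i ξ).det) ^ (s i)) (Finset.mem_univ _)]
    rw [mul_assoc, hprod, ← Finset.prod_mul_distrib, ← hξR, hδ s R hRH, hξR, chi]
    refine Finset.prod_congr rfl fun i _ => ?_
    rw [hR.tdiag_eq, hratio, Real.mul_rpow (hn i).le (sq_nonneg _), ← mul_assoc,
      ← Real.rpow_add (hn i), neg_add_cancel, Real.rpow_zero, one_mul, Real.rpow_mul (hτ i).le,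
      Real.rpow_two]

end Wishart
end
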